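/- arXiv:2311.13441 — 3 statements merged into one kernel-verified Lean document; each statement's English description precedes it below -/
import Mathlib

section
/- Suppose ξ_1, ξ_2, ... are point processes on ℝ, almost surely infinite in both directions, such that for every fixed compact interval I ⊂ ℝ and every fixed k ≥ 0 there is a constant C_{I,k} with sup_ℓ E[ξ_ℓ(I)^k] ≤ C_{I,k}. If ξ is a point process on ℝ, almost surely infinite in both directions, and ξ_ℓ converges in distribution to ξ, then ξ(I) has finite k-th moments for all compact intervals I and all k, and ξ_ℓ converges in correlation to ξ. -/
open MeasureTheory Filter Topology Bornology

noncomputable def xLabel (μ : MeasureTheory.Measure ℝ) (n : ℤ) : ℝ :=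
  if 0 < n then sInf {x : ℝ | 0 < x ∧ (n.toNat : ENNReal) ≤ μ (Set.Ioc 0 x)}
  else sSup {x : ℝ | x ≤ 0 ∧ ((1 - n).toNat : ENNReal) ≤ μ (Set.Ioc x 0)}

def IsPointMeasure (μ : MeasureTheory.Measure ℝ) : Prop :=
  ∀ B : Set ℝ, MeasurableSet B → IsBounded B → ∃ m : ℕ, μ B = m

def InfiniteBothDirections (μ : MeasureTheory.Measure ℝ) : Prop :=
  μ (Set.Iio 0) = ⊤ ∧ μ (Set.Ioi 0) = ⊤

open Classical in
/-- The `k`-point correlation sum `C_k(μ, f)`: the sum over tuples of pairwise distinct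
indices `(n_1,...,n_k) ∈ ℤ^k` of `f(x_{n_1}(μ),...,x_{n_k}(μ))`. -/
noncomputable def corrSumM (μ : MeasureTheory.Measure ℝ) (k : ℕ) (f : (Fin k → ℝ) → ℝ) : ℝ :=
  ∑' m : Fin k → ℤ, if Function.Injective m then f (fun i => xLabel μ (m i)) else 0

/-- Convergence in correlation of point processes. -/
def ConvInCorr {Ω : Type*} [MeasurableSpace Ω] (P : MeasureTheory.Measure Ω)
    (ξs : ℕ → Ω → MeasureTheory.Measure ℝ) (ξ : Ω → MeasureTheory.Measure ℝ) : Prop :=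
  ∀ k : ℕ, 1 ≤ k → ∀ f : (Fin k → ℝ) → ℝ, Continuous f → HasCompactSupport f →
    Tendsto (fun ℓ => ∫ ω, corrSumM (ξs ℓ ω) k f ∂P) atTop
      (𝓝 (∫ ω, corrSumM (ξ ω) k f ∂P))

/-- Convergence in distribution of point processes, in the sense of linear statistics. -/
def ConvInDist {Ω : Type*} [MeasurableSpace Ω] (P : MeasureTheory.Measure Ω)
    (ξs : ℕ → Ω → MeasureTheory.Measure ℝ) (ξ : Ω → MeasureTheory.Measure ℝ) : Prop :=
  ∀ f : ℝ → ℝ, Continuous f → HasCompactSupport f →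
    ∀ g : BoundedContinuousFunction ℝ ℝ,
    Tendsto (fun ℓ => ∫ ω, g (∫ x, f x ∂(ξs ℓ ω)) ∂P) atTop
      (𝓝 (∫ ω, g (∫ x, f x ∂(ξ ω)) ∂P))

/-- Realizations of a point process that is infinite in both directions. -/
def IsGoodMeasure (μ : Measure ℝ) : Prop := IsPointMeasure μ ∧ InfiniteBothDirections μ

lemma IsPointMeasure.exists_gt_measure_Ioc_eq_zero {μ : Measure ℝ} (h : IsPointMeasure μ) (x : ℝ) :
    ∃ y > x, μ (Set.Ioc x y) = 0 := by
  have ht : Tendsto (fun j : ℕ => μ (Set.Ioc x (x + 1 / ((j : ℝ) + 1)))) atTop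
      (𝓝 (μ (⋂ j : ℕ, Set.Ioc x (x + 1 / ((j : ℝ) + 1))))) := by
    refine tendsto_measure_iInter_atTop (fun j => measurableSet_Ioc.nullMeasurableSet) ?_ ?_
    · intro i j hij
      refine Set.Ioc_subset_Ioc_right ?_
      gcongr
    · refine ⟨0, ?_⟩
      obtain ⟨m, hm⟩ := h (Set.Ioc x (x + 1 / (((0 : ℕ) : ℝ) + 1))) measurableSet_Ioc
        (Metric.isBounded_Ioc _ _)
      rw [hm]
      exact ENNReal.natCast_ne_top m
  have he : (⋂ j : ℕ, Set.Ioc x (x + 1 / ((j : ℝ) + 1))) = ∅ := by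
    ext y
    simp only [Set.mem_iInter, Set.mem_Ioc, Set.mem_empty_iff_false, iff_false]
    intro hy
    obtain ⟨j, hj⟩ := exists_nat_one_div_lt (sub_pos.2 (hy 0).1)
    linarith [(hy j).2]
  rw [he, measure_empty] at ht
  obtain ⟨j, hj⟩ := (ht.eventually_lt_const (zero_lt_one)).exists
  refine ⟨x + 1 / ((j : ℝ) + 1), ?_, ?_⟩
  · have : 0 < 1 / ((j : ℝ) + 1) := by positivity
    linarith
  · obtain ⟨m, hm⟩ := h (Set.Ioc x (x + 1 / ((j : ℝ) + 1))) measurableSet_Ioc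
        (Metric.isBounded_Ioc _ _)
    rw [hm] at hj ⊢
    have : m < 1 := by exact_mod_cast hj
    simp [Nat.lt_one_iff.1 this]

lemma InfiniteBothDirections.exists_le_measure_Ioc_right {μ : Measure ℝ}
    (h : InfiniteBothDirections μ) (m : ℕ) : ∃ x > 0, (m : ENNReal) ≤ μ (Set.Ioc 0 x) := by
  have ht : Tendsto (fun j : ℕ => μ (Set.Ioc 0 (j : ℝ))) atTop
      (𝓝 (μ (⋃ j : ℕ, Set.Ioc 0 (j : ℝ)))) := by
    refine tendsto_measure_iUnion_atTop ?_
    intro i j hij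
    exact Set.Ioc_subset_Ioc_right (by exact_mod_cast hij)
  have he : (⋃ j : ℕ, Set.Ioc 0 (j : ℝ)) = Set.Ioi 0 := by
    ext y
    simp only [Set.mem_iUnion, Set.mem_Ioc, Set.mem_Ioi]
    exact ⟨fun ⟨_, hj⟩ => hj.1, fun hy => (exists_nat_ge y).imp fun _ hj => ⟨hy, hj⟩⟩
  rw [he, h.2] at ht
  obtain ⟨j, hj, hj0⟩ := ((ht.eventually_const_lt (ENNReal.natCast_lt_top m)).and
    (eventually_gt_atTop 0)).exists
  exact ⟨j, by exact_mod_cast hj0, hj.le⟩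

lemma InfiniteBothDirections.exists_le_measure_Ioc_left {μ : Measure ℝ}
    (h : InfiniteBothDirections μ) (m : ℕ) : ∃ x ≤ 0, (m : ENNReal) ≤ μ (Set.Ioc x 0) := by
  have ht : Tendsto (fun j : ℕ => μ (Set.Ioc (-(j : ℝ)) 0)) atTop
      (𝓝 (μ (⋃ j : ℕ, Set.Ioc (-(j : ℝ)) 0))) := by
    refine tendsto_measure_iUnion_atTop ?_
    intro i j hij
    exact Set.Ioc_subset_Ioc_left (neg_le_neg (by exact_mod_cast hij))
  have he : Set.Iio 0 ⊆ (⋃ j : ℕ, Set.Ioc (-(j : ℝ)) 0) := by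
    intro y hy
    simp only [Set.mem_iUnion, Set.mem_Ioc]
    obtain ⟨j, hj⟩ := exists_nat_gt (-y)
    exact ⟨j, by linarith, le_of_lt hy⟩
  have htop : μ (⋃ j : ℕ, Set.Ioc (-(j : ℝ)) 0) = ⊤ :=
    top_le_iff.1 (h.1 ▸ measure_mono he)
  rw [htop] at ht
  obtain ⟨j, hj⟩ := (ht.eventually_const_lt (ENNReal.natCast_lt_top m)).exists
  exact ⟨-j, by simp, hj.le⟩

/-- The labels of a good measure form a lower adjoint of its signed counting function. -/
lemma IsGoodMeasure.exists_counting {μ : Measure ℝ} (h : IsGoodMeasure μ) :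
    ∃ F : ℝ → ℤ, (∀ a b, a < b → μ (Set.Ioc a b) = ((F b - F a).toNat : ENNReal)) ∧
      ∀ n x, xLabel μ n ≤ x ↔ n ≤ F x := by
  obtain ⟨hp, hi⟩ := h
  choose N hN using fun a b : ℝ => hp (Set.Ioc a b) measurableSet_Ioc (Metric.isBounded_Ioc a b)
  have hempty : ∀ a b, b ≤ a → N a b = 0 := by
    intro a b hab
    have := hN a b
    rw [Set.Ioc_eq_empty (not_lt.2 hab), measure_empty] at this
    exact_mod_cast this.symm
  have hadd : ∀ a b c, a ≤ b → b ≤ c → N a c = N a b + N b c := by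
    intro a b c hab hbc
    have : μ (Set.Ioc a c) = μ (Set.Ioc a b) + μ (Set.Ioc b c) := by
      rw [← Set.Ioc_union_Ioc_eq_Ioc hab hbc]
      exact measure_union (Set.Ioc_disjoint_Ioc_of_le le_rfl) measurableSet_Ioc
    rw [hN, hN, hN] at this
    exact_mod_cast this
  have hR : ∀ x, ∃ y > x, N x y = 0 := by
    intro x
    obtain ⟨y, hy, h0⟩ := hp.exists_gt_measure_Ioc_eq_zero x
    rw [hN] at h0
    exact ⟨y, hy, by exact_mod_cast h0⟩
  have hF : ∀ a b, a ≤ b → ((N 0 b : ℤ) - N b 0) - ((N 0 a : ℤ) - N a 0) = N a b := by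
    intro a b hab
    rcases le_total 0 a with ha | ha
    · have h1 := hempty b 0 (ha.trans hab)
      have h2 := hempty a 0 ha
      have h3 := hadd 0 a b ha hab
      lia
    · rcases le_total 0 b with hb | hb
      · have h1 := hempty b 0 hb
        have h2 := hempty 0 a ha
        have h3 := hadd a 0 b ha hb
        lia
      · have h1 := hempty 0 b hb
        have h2 := hempty 0 a ha
        have h3 := hadd a b 0 hab hb
        lia
  refine ⟨fun x => (N 0 x : ℤ) - N x 0, ?_, ?_⟩
  · intro a b hab
    rw [hF a b hab.le, hN]
    simp
  · intro n x
    dsimp only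
    unfold xLabel
    simp only [hN, Nat.cast_le]
    split_ifs with hn
    · have hbdd : BddBelow {x : ℝ | 0 < x ∧ n.toNat ≤ N 0 x} := ⟨0, fun y hy => hy.1.le⟩
      have hne : {x : ℝ | 0 < x ∧ n.toNat ≤ N 0 x}.Nonempty := by
        obtain ⟨y, hy, h1⟩ := hi.exists_le_measure_Ioc_right n.toNat
        rw [hN] at h1
        exact ⟨y, hy, by exact_mod_cast h1⟩
      rcases lt_or_ge x 0 with hx | hx
      · have h1 := hempty 0 x hx.le
        refine iff_of_false ?_ (by lia)
        exact not_le.2 (hx.trans_le (le_csInf hne fun y hy => hy.1.le))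
      · have h1 := hempty x 0 hx
        constructor
        · intro hle
          obtain ⟨y, hxy, hy⟩ := hR x
          obtain ⟨s, hs, hsy⟩ := exists_lt_of_csInf_lt hne (hle.trans_lt hxy)
          have h2 := hadd 0 x y hx hxy.le
          have h3 := hadd 0 s y hs.1.le hsy.le
          have h4 := hs.2
          lia
        · intro hle
          refine csInf_le hbdd ⟨?_, by lia⟩
          by_contra hx0
          have := hempty 0 x (not_lt.1 hx0)
          lia
    · have hbdd : BddAbove {x : ℝ | x ≤ 0 ∧ (1 - n).toNat ≤ N x 0} := ⟨0, fun y hy => hy.1⟩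
      have hne : {x : ℝ | x ≤ 0 ∧ (1 - n).toNat ≤ N x 0}.Nonempty := by
        obtain ⟨y, hy, h1⟩ := hi.exists_le_measure_Ioc_left (1 - n).toNat
        rw [hN] at h1
        exact ⟨y, hy, by exact_mod_cast h1⟩
      rcases lt_or_ge x 0 with hx | hx
      · have h1 := hempty 0 x hx.le
        constructor
        · intro hle
          by_contra hcon
          obtain ⟨y, hxy, hy⟩ := hR x
          have hm : N x (min y 0) = 0 := by
            have := hadd x (min y 0) y (le_min hxy.le hx.le) (min_le_left _ _)
            lia
          have h2 := hadd x (min y 0) 0 (le_min hxy.le hx.le) (min_le_right _ _)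
          have h3 := (le_csSup hbdd ⟨min_le_right y 0, by lia⟩).trans hle
          exact absurd h3 (not_le.2 (lt_min hxy hx))
        · intro hle
          refine csSup_le hne fun s hs => ?_
          by_contra hsx
          have h2 := hadd x s 0 (not_le.1 hsx).le hs.1
          have h3 := hs.2
          lia
      · have h1 := hempty x 0 hx
        refine iff_of_true ?_ (by lia)
        exact (csSup_le hne fun y hy => hy.1).trans hx

lemma IsPointMeasure.isLocallyFiniteMeasure {μ : Measure ℝ} (h : IsPointMeasure μ) :
    IsLocallyFiniteMeasure μ := by
  refine ⟨fun x => ⟨Metric.ball x 1, Metric.ball_mem_nhds x one_pos, ?_⟩⟩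
  obtain ⟨m, hm⟩ := h (Metric.ball x 1) measurableSet_ball Metric.isBounded_ball
  rw [hm]
  exact ENNReal.natCast_lt_top m

lemma IsGoodMeasure.finite_setOf_abs_xLabel_le {μ : Measure ℝ} (h : IsGoodMeasure μ) (R : ℝ) :
    {n : ℤ | |xLabel μ n| ≤ R}.Finite := by
  obtain ⟨F, -, hF⟩ := h.exists_counting
  refine (Set.finite_Ioc (F (-R - 1)) (F R)).subset fun n (hn : |xLabel μ n| ≤ R) => ⟨?_, ?_⟩
  · refine lt_of_not_ge fun hle => ?_
    linarith [(hF n (-R - 1)).2 hle, (abs_le.1 hn).1]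
  · exact (hF n R).1 (abs_le.1 hn).2

lemma IsGoodMeasure.eq_sum_dirac {μ : Measure ℝ} (h : IsGoodMeasure μ) :
    μ = Measure.sum fun n : ℤ => Measure.dirac (xLabel μ n) := by
  have := h.1.isLocallyFiniteMeasure
  obtain ⟨F, hcount, hF⟩ := h.exists_counting
  refine Measure.ext_of_Ioc _ _ fun a b hab => ?_
  rw [Measure.sum_apply _ measurableSet_Ioc, hcount a b hab]
  have hind : ∀ n : ℤ, Measure.dirac (xLabel μ n) (Set.Ioc a b)
      = if n ∈ Finset.Ioc (F a) (F b) then 1 else 0 := by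
    intro n
    rw [Measure.dirac_apply' _ measurableSet_Ioc, Set.indicator_apply]
    simp only [Set.mem_Ioc, Finset.mem_Ioc, hF, ← not_le, Pi.one_apply]
  simp_rw [hind]
  rw [tsum_eq_sum (s := Finset.Ioc (F a) (F b)) (fun n hn => if_neg hn),
    Finset.sum_congr rfl (fun n hn => if_pos hn)]
  simp [Int.card_Ioc]

open scoped CompactlySupported

/-- The linear statistic of a compactly supported continuous function. -/
noncomputable def linStat (f : C_c(ℝ, ℝ)) (μ : Measure ℝ) : ℝ := ∫ x, f x ∂μ

/-- The terms of the correlation sum. -/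
noncomputable def corrTerm (μ : Measure ℝ) (k : ℕ) (f : (Fin k → ℝ) → ℝ) : (Fin k → ℤ) → ℝ :=
  {m | Function.Injective m}.indicator fun m => f fun i => xLabel μ (m i)

lemma corrSumM_eq_tsum_corrTerm (μ : Measure ℝ) (k : ℕ) (f : (Fin k → ℝ) → ℝ) :
    corrSumM μ k f = ∑' m, corrTerm μ k f m := by
  unfold corrSumM corrTerm
  refine tsum_congr fun m => ?_
  by_cases hm : Function.Injective m <;> simp [hm]

/-- The tensor product of functions of one variable. -/
def tensorFun {k : ℕ} (f : Fin k → C_c(ℝ, ℝ)) (x : Fin k → ℝ) : ℝ := ∏ i, f i (x i)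

lemma continuous_tensorFun {k : ℕ} (f : Fin k → C_c(ℝ, ℝ)) : Continuous (tensorFun f) :=
  continuous_finsetProd _ fun i _ => (f i).continuous.comp (continuous_apply i)

lemma hasCompactSupport_tensorFun {k : ℕ} (f : Fin k → C_c(ℝ, ℝ)) :
    HasCompactSupport (tensorFun f) := by
  refine HasCompactSupport.intro (isCompact_univ_pi fun i => (f i).hasCompactSupport) fun x hx => ?_
  simp only [Set.mem_pi, Set.mem_univ, true_imp_iff, not_forall] at hx
  obtain ⟨i, hi⟩ := hx
  exact Finset.prod_eq_zero (Finset.mem_univ i) (image_eq_zero_of_notMem_tsupport hi)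

lemma linStat_add (f g : C_c(ℝ, ℝ)) {μ : Measure ℝ} (h : IsGoodMeasure μ) :
    linStat (f + g) μ = linStat f μ + linStat g μ := by
  have := h.1.isLocallyFiniteMeasure
  exact integral_add (f.continuous.integrable_of_hasCompactSupport f.hasCompactSupport)
    (g.continuous.integrable_of_hasCompactSupport g.hasCompactSupport)

lemma linStat_smul (c : ℝ) (f : C_c(ℝ, ℝ)) (μ : Measure ℝ) :
    linStat (c • f) μ = c * linStat f μ :=
  integral_const_mul c f

lemma IsGoodMeasure.finite_support {μ : Measure ℝ} (h : IsGoodMeasure μ) {k : ℕ}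
    {f : (Fin k → ℝ) → ℝ} (hf : HasCompactSupport f) :
    (Function.support fun m : Fin k → ℤ => f fun i => xLabel μ (m i)).Finite := by
  obtain ⟨R, hR⟩ := hf.isCompact.isBounded.exists_norm_le
  refine (Set.Finite.pi' fun _ : Fin k => h.finite_setOf_abs_xLabel_le R).subset fun m hm i => ?_
  exact (norm_le_pi_norm (fun i => xLabel μ (m i)) i).trans (hR _ (subset_tsupport f hm))

lemma IsGoodMeasure.summable_corrTerm {μ : Measure ℝ} (h : IsGoodMeasure μ) {k : ℕ}
    {f : (Fin k → ℝ) → ℝ} (hf : HasCompactSupport f) : Summable (corrTerm μ k f) :=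
  summable_of_hasFiniteSupport <| (h.finite_support hf).subset <| by
    rw [corrTerm, Set.support_indicator]
    exact Set.inter_subset_right

lemma IsGoodMeasure.hasSum_linStat {μ : Measure ℝ} (h : IsGoodMeasure μ) (f : C_c(ℝ, ℝ)) :
    HasSum (fun n : ℤ => f (xLabel μ n)) (linStat f μ) := by
  have := h.1.isLocallyFiniteMeasure
  have hi := f.continuous.integrable_of_hasCompactSupport (μ := μ) f.hasCompactSupport
  have hs := h.eq_sum_dirac
  rw [hs] at hi
  have := hasSum_integral_measure hi
  simp only [integral_dirac] at this
  rwa [← hs] at this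

lemma IsGoodMeasure.corrSumM_sum {μ : Measure ℝ} (h : IsGoodMeasure μ) {k : ℕ} {ι : Type*}
    (s : Finset ι) (c : ι → ℝ) (f : ι → (Fin k → ℝ) → ℝ) (hf : ∀ i, HasCompactSupport (f i)) :
    corrSumM μ k (fun x => ∑ i ∈ s, c i * f i x) = ∑ i ∈ s, c i * corrSumM μ k (f i) := by
  simp_rw [corrSumM_eq_tsum_corrTerm, ← tsum_mul_left]
  rw [← Summable.tsum_finsetSum fun i _ => (h.summable_corrTerm (hf i)).mul_left _]
  refine tsum_congr fun m => ?_
  by_cases hm : Function.Injective m <;> simp [corrTerm, hm]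

lemma IsGoodMeasure.abs_corrSumM_sub_le {μ : Measure ℝ} (h : IsGoodMeasure μ) {k : ℕ}
    {f g u : (Fin k → ℝ) → ℝ} (hf : HasCompactSupport f) (hg : HasCompactSupport g)
    (hu : HasCompactSupport u) {ε : ℝ} (hfg : ∀ x, |f x - g x| ≤ ε * u x) :
    |corrSumM μ k f - corrSumM μ k g| ≤ ε * corrSumM μ k u := by
  simp_rw [corrSumM_eq_tsum_corrTerm, ← tsum_mul_left]
  rw [← (h.summable_corrTerm hf).tsum_sub (h.summable_corrTerm hg)]
  rw [← Real.norm_eq_abs]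
  refine tsum_of_norm_bounded ((h.summable_corrTerm hu).mul_left ε).hasSum fun m => ?_
  by_cases hm : Function.Injective m
  · simpa [corrTerm, hm] using hfg _
  · simp [corrTerm, hm]

lemma corrSumM_tensorFun_zero (μ : Measure ℝ) (f : Fin 0 → C_c(ℝ, ℝ)) :
    corrSumM μ 0 (tensorFun f) = 1 := by
  rw [corrSumM_eq_tsum_corrTerm,
    tsum_eq_single default (fun m hm => absurd (Subsingleton.elim _ _) hm)]
  simp [corrTerm, tensorFun, Function.injective_of_subsingleton]

lemma tensorFun_update_mul {k : ℕ} (f : Fin k → C_c(ℝ, ℝ)) (g : C_c(ℝ, ℝ)) (i : Fin k)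
    (x : Fin k → ℝ) :
    tensorFun (Function.update f i (f i * g)) x = tensorFun f x * g (x i) := by
  have : ∀ j, (Function.update f i (f i * g)) j (x j)
      = f j (x j) * if j = i then g (x i) else 1 := by
    intro j
    by_cases hj : j = i
    · subst hj; simp
    · simp [hj]
  simp_rw [tensorFun, this, Finset.prod_mul_distrib]
  simp

lemma IsGoodMeasure.corrSumM_tensorFun_succ {μ : Measure ℝ} (h : IsGoodMeasure μ) {k : ℕ}
    (f : Fin (k + 1) → C_c(ℝ, ℝ)) :
    corrSumM μ (k + 1) (tensorFun f)
      = corrSumM μ k (tensorFun (Fin.tail f)) * linStat (f 0) μ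
        - ∑ i, corrSumM μ k
          (tensorFun (Function.update (Fin.tail f) i (Fin.tail f i * f 0))) := by
  simp_rw [corrSumM_eq_tsum_corrTerm]
  let e : (Fin k → ℤ) × ℤ ≃ (Fin (k + 1) → ℤ) :=
    (Equiv.prodComm _ _).trans (Fin.consEquiv fun _ => ℤ)
  have hsum : Summable fun c => corrTerm μ (k + 1) (tensorFun f) (e c) :=
    e.summable_iff.2 (h.summable_corrTerm (hasCompactSupport_tensorFun f))
  have hinner : ∀ m : Fin k → ℤ,
      ∑' n : ℤ, corrTerm μ (k + 1) (tensorFun f) (e (m, n))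
        = corrTerm μ k (tensorFun (Fin.tail f)) m * linStat (f 0) μ
          - ∑ i, corrTerm μ k
            (tensorFun (Function.update (Fin.tail f) i (Fin.tail f i * f 0))) m := by
    intro m
    by_cases hm : Function.Injective m
    · have hterm : ∀ n : ℤ, corrTerm μ (k + 1) (tensorFun f) (e (m, n))
          = tensorFun (Fin.tail f) (fun i => xLabel μ (m i)) *
            (f 0 (xLabel μ n) - if n ∈ Finset.univ.image m then f 0 (xLabel μ n) else 0) := by
        intro n
        have he : e (m, n) = Fin.cons n m := rfl
        rw [he]
        by_cases hn : n ∈ Set.range m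
        · have : ¬ Function.Injective (Fin.cons n m : Fin (k + 1) → ℤ) := by
            rw [Fin.cons_injective_iff]; tauto
          have hn' : n ∈ Finset.univ.image m := by simpa using hn
          simp [corrTerm, this, hn']
        · have : Function.Injective (Fin.cons n m : Fin (k + 1) → ℤ) := by
            rw [Fin.cons_injective_iff]; tauto
          have hn' : n ∉ Finset.univ.image m := by simpa using hn
          rw [if_neg hn', corrTerm, Set.indicator_of_mem this]
          simp [tensorFun, Fin.prod_univ_succ, Fin.tail, mul_comm]
      have h2 : HasSum (fun n : ℤ => if n ∈ Finset.univ.image m then f 0 (xLabel μ n) else 0)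
          (∑ n ∈ Finset.univ.image m, f 0 (xLabel μ n)) := by
        have := hasSum_sum_of_ne_finset_zero (L := .unconditional ℤ) (s := Finset.univ.image m)
          (f := fun n : ℤ => if n ∈ Finset.univ.image m then f 0 (xLabel μ n) else 0)
          (fun n hn => if_neg hn)
        rwa [Finset.sum_congr rfl fun n hn => if_pos hn] at this
      simp_rw [hterm]
      rw [(((h.hasSum_linStat (f 0)).sub h2).mul_left _).tsum_eq, Finset.sum_image hm.injOn]
      simp [corrTerm, hm, tensorFun_update_mul, mul_sub, Finset.mul_sum]
    · have : ∀ n, ¬ Function.Injective (e (m, n)) := by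
        intro n hn
        exact hm (Fin.cons_injective_iff.1 hn).2
      simp [corrTerm, hm, this]
  have hs : ∀ i, Summable (corrTerm μ k
      (tensorFun (Function.update (Fin.tail f) i (Fin.tail f i * f 0)))) :=
    fun i => h.summable_corrTerm (hasCompactSupport_tensorFun _)
  rw [← e.tsum_eq, Summable.tsum_prod hsum]
  simp_rw [hinner]
  rw [Summable.tsum_sub ((h.summable_corrTerm (hasCompactSupport_tensorFun _)).mul_right _)
    (summable_sum fun i _ => hs i), tsum_mul_right, Summable.tsum_finsetSum fun i _ => hs i]

/-- Convergence of the expectations of a functional of random measures, including its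
integrability. -/
def ConvInMean {Ω : Type*} [MeasurableSpace Ω] (P : Measure Ω)
    (ξs : ℕ → Ω → Measure ℝ) (ξ : Ω → Measure ℝ) (Φ : Measure ℝ → ℝ) : Prop :=
  (∀ ℓ, Integrable (fun ω => Φ (ξs ℓ ω)) P) ∧ Integrable (fun ω => Φ (ξ ω)) P ∧
    Tendsto (fun ℓ => ∫ ω, Φ (ξs ℓ ω) ∂P) atTop (𝓝 (∫ ω, Φ (ξ ω) ∂P))

section ConvInMean

variable {Ω : Type*} [MeasurableSpace Ω] {P : Measure Ω}
  {ξs : ℕ → Ω → Measure ℝ} {ξ : Ω → Measure ℝ} {Φ Ψ : Measure ℝ → ℝ}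

lemma ConvInMean.congr (hpp : ∀ᵐ ω ∂P, IsGoodMeasure (ξ ω))
    (hpps : ∀ ℓ, ∀ᵐ ω ∂P, IsGoodMeasure (ξs ℓ ω)) (hΦ : ConvInMean P ξs ξ Φ)
    (h : ∀ μ, IsGoodMeasure μ → Φ μ = Ψ μ) : ConvInMean P ξs ξ Ψ := by
  have h1 : ∀ ℓ, (fun ω => Φ (ξs ℓ ω)) =ᵐ[P] fun ω => Ψ (ξs ℓ ω) :=
    fun ℓ => (hpps ℓ).mono fun ω hω => h _ hω
  have h2 : (fun ω => Φ (ξ ω)) =ᵐ[P] fun ω => Ψ (ξ ω) := hpp.mono fun ω hω => h _ hω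
  refine ⟨fun ℓ => (hΦ.1 ℓ).congr (h1 ℓ), hΦ.2.1.congr h2, ?_⟩
  rw [← integral_congr_ae h2]
  exact hΦ.2.2.congr fun ℓ => integral_congr_ae (h1 ℓ)

lemma ConvInMean.sub (hΦ : ConvInMean P ξs ξ Φ) (hΨ : ConvInMean P ξs ξ Ψ) :
    ConvInMean P ξs ξ fun μ => Φ μ - Ψ μ := by
  refine ⟨fun ℓ => (hΦ.1 ℓ).sub (hΨ.1 ℓ), hΦ.2.1.sub hΨ.2.1, ?_⟩
  rw [integral_sub hΦ.2.1 hΨ.2.1]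
  exact (hΦ.2.2.sub hΨ.2.2).congr fun ℓ => (integral_sub (hΦ.1 ℓ) (hΨ.1 ℓ)).symm

lemma ConvInMean.const_mul (c : ℝ) (hΦ : ConvInMean P ξs ξ Φ) :
    ConvInMean P ξs ξ fun μ => c * Φ μ := by
  refine ⟨fun ℓ => (hΦ.1 ℓ).const_mul c, hΦ.2.1.const_mul c, ?_⟩
  simp_rw [integral_const_mul]
  exact hΦ.2.2.const_mul c

lemma ConvInMean.finsetSum {ι : Type*} (s : Finset ι) {Φ : ι → Measure ℝ → ℝ}
    (hΦ : ∀ i ∈ s, ConvInMean P ξs ξ (Φ i)) : ConvInMean P ξs ξ fun μ => ∑ i ∈ s, Φ i μ := by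
  refine ⟨fun ℓ => integrable_finsetSum _ fun i hi => (hΦ i hi).1 ℓ,
    integrable_finsetSum _ fun i hi => (hΦ i hi).2.1, ?_⟩
  rw [integral_finsetSum _ fun i hi => (hΦ i hi).2.1]
  exact (tendsto_finsetSum _ fun i hi => (hΦ i hi).2.2).congr fun ℓ =>
    (integral_finsetSum _ fun i hi => (hΦ i hi).1 ℓ).symm

lemma integrable_of_forall_approx {η : Ω → Measure ℝ} (hη : ∀ᵐ ω ∂P, IsGoodMeasure (η ω))
    (hΨ : Integrable (fun ω => Ψ (η ω)) P)
    (h : ∀ ε > 0, ∃ Φ' : Measure ℝ → ℝ, Integrable (fun ω => Φ' (η ω)) P ∧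
      ∀ μ, IsGoodMeasure μ → |Φ μ - Φ' μ| ≤ ε * Ψ μ) :
    Integrable (fun ω => Φ (η ω)) P := by
  choose! Φ' hInt hle using fun n : ℕ => h (1 / ((n : ℝ) + 1)) (by positivity)
  have hm : AEStronglyMeasurable (fun ω => Φ (η ω)) P := by
    refine aestronglyMeasurable_of_tendsto_ae atTop (fun n => (hInt n).1) ?_
    filter_upwards [hη] with ω hω
    rw [tendsto_iff_norm_sub_tendsto_zero]
    have hz := (tendsto_one_div_add_atTop_nhds_zero_nat (𝕜 := ℝ)).mul_const (Ψ (η ω))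
    rw [zero_mul] at hz
    refine squeeze_zero (fun _ => norm_nonneg _) (fun n => ?_) hz
    rw [norm_sub_rev]
    exact hle n _ hω
  refine ((hInt 0).norm.add (hΨ.const_mul (1 / (((0 : ℕ) : ℝ) + 1)))).mono' hm ?_
  filter_upwards [hη] with ω hω
  have h1 := hle 0 _ hω
  have h2 := norm_add_le (Φ' 0 (η ω)) (Φ (η ω) - Φ' 0 (η ω))
  rw [add_sub_cancel] at h2
  exact h2.trans (add_le_add_right h1 _)

lemma abs_integral_sub_le_of_abs_sub_le {η : Ω → Measure ℝ} {Φ' : Measure ℝ → ℝ}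
    (hη : ∀ᵐ ω ∂P, IsGoodMeasure (η ω))
    (hΦ : Integrable (fun ω => Φ (η ω)) P) (hΦ' : Integrable (fun ω => Φ' (η ω)) P)
    (hΨ : Integrable (fun ω => Ψ (η ω)) P) {ε : ℝ}
    (h : ∀ μ, IsGoodMeasure μ → |Φ μ - Φ' μ| ≤ ε * Ψ μ) :
    |∫ ω, Φ (η ω) ∂P - ∫ ω, Φ' (η ω) ∂P| ≤ ε * ∫ ω, Ψ (η ω) ∂P := by
  rw [← integral_sub hΦ hΦ', ← integral_const_mul]
  exact (abs_integral_le_integral_abs).trans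
    (integral_mono_ae (hΦ.sub hΦ').abs (hΨ.const_mul ε) (hη.mono fun ω hω => h _ hω))

lemma ConvInMean.of_forall_approx (hpp : ∀ᵐ ω ∂P, IsGoodMeasure (ξ ω))
    (hpps : ∀ ℓ, ∀ᵐ ω ∂P, IsGoodMeasure (ξs ℓ ω)) {C : ℝ} (hC : 0 ≤ C)
    (hΨs : ∀ ℓ, Integrable (fun ω => Ψ (ξs ℓ ω)) P ∧ ∫ ω, Ψ (ξs ℓ ω) ∂P ≤ C)
    (hΨ : Integrable (fun ω => Ψ (ξ ω)) P ∧ ∫ ω, Ψ (ξ ω) ∂P ≤ C)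
    (h : ∀ ε > 0, ∃ Φ', ConvInMean P ξs ξ Φ' ∧
      ∀ μ, IsGoodMeasure μ → |Φ μ - Φ' μ| ≤ ε * Ψ μ) :
    ConvInMean P ξs ξ Φ := by
  have h1 : ∀ ℓ, Integrable (fun ω => Φ (ξs ℓ ω)) P := fun ℓ =>
    integrable_of_forall_approx (hpps ℓ) (hΨs ℓ).1 fun ε hε =>
      (h ε hε).imp fun Φ' hΦ' => ⟨hΦ'.1.1 ℓ, hΦ'.2⟩
  have h2 : Integrable (fun ω => Φ (ξ ω)) P :=
    integrable_of_forall_approx hpp hΨ.1 fun ε hε =>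
      (h ε hε).imp fun Φ' hΦ' => ⟨hΦ'.1.2.1, hΦ'.2⟩
  refine ⟨h1, h2, ?_⟩
  rw [Metric.tendsto_nhds]
  intro δ hδ
  have hε : 0 < δ / (3 * (C + 1)) := by positivity
  obtain ⟨Φ', hΦ', hle⟩ := h _ hε
  have hεC : δ / (3 * (C + 1)) * C ≤ δ / 3 := by
    rw [div_mul_eq_mul_div, div_le_div_iff₀ (by positivity) (by positivity)]
    nlinarith
  filter_upwards [Metric.tendsto_nhds.1 hΦ'.2.2 (δ / 3) (by positivity)] with ℓ hℓ
  rw [Real.dist_eq] at hℓ ⊢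
  have ha := (abs_integral_sub_le_of_abs_sub_le (hpps ℓ) (h1 ℓ) (hΦ'.1 ℓ) (hΨs ℓ).1 hle).trans
    ((mul_le_mul_of_nonneg_left (hΨs ℓ).2 hε.le).trans hεC)
  have hb := (abs_integral_sub_le_of_abs_sub_le hpp h2 hΦ'.2.1 hΨ.1 hle).trans
    ((mul_le_mul_of_nonneg_left hΨ.2 hε.le).trans hεC)
  rw [abs_le] at ha hb
  rw [abs_lt] at hℓ ⊢
  constructor <;> linarith [ha.1, ha.2, hb.1, hb.2, hℓ.1, hℓ.2]

lemma measurable_linStat (f : C_c(ℝ, ℝ)) {η : Ω → Measure ℝ} (hη : Measurable η) :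
    Measurable fun ω => linStat f (η ω) := by
  have := StronglyMeasurable.integral_kernel (κ := (⟨η, hη⟩ : ProbabilityTheory.Kernel Ω ℝ))
    f.continuous.stronglyMeasurable
  exact this.measurable

end ConvInMean

lemma exists_abs_linStat_le (f : C_c(ℝ, ℝ)) : ∃ R K : ℝ, 0 ≤ K ∧ ∀ μ, IsPointMeasure μ →
    |linStat f μ| ≤ K * (μ (Set.Icc (-R) R)).toReal := by
  obtain ⟨R, hR⟩ := f.hasCompactSupport.isCompact.isBounded.exists_norm_le
  obtain ⟨K, hK⟩ := f.continuous.bounded_above_of_compact_support f.hasCompactSupport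
  refine ⟨R, K, (norm_nonneg _).trans (hK 0), fun μ hμ => ?_⟩
  have : linStat f μ = ∫ x in Set.Icc (-R) R, f x ∂μ := by
    refine (setIntegral_eq_integral_of_forall_compl_eq_zero fun x hx => ?_).symm
    by_contra hne
    exact hx (abs_le.1 (hR x (subset_tsupport _ hne)))
  rw [this]
  obtain ⟨m, hm⟩ := hμ _ (measurableSet_Icc (a := -R) (b := R)) (Metric.isBounded_Icc _ _)
  refine norm_setIntegral_le_of_norm_le_const ?_ fun x _ => hK x
  rw [hm]
  exact ENNReal.natCast_lt_top m

section Moments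

variable {Ω : Type*} [MeasurableSpace Ω] {P : Measure Ω}
  {ξs : ℕ → Ω → Measure ℝ} {ξ : Ω → Measure ℝ}

lemma exists_integral_abs_linStat_pow_le (hmeass : ∀ ℓ, Measurable (ξs ℓ))
    (hpps : ∀ ℓ, ∀ᵐ ω ∂P, IsGoodMeasure (ξs ℓ ω))
    (hmoms : ∀ (a b : ℝ) (k : ℕ), ∃ C : ENNReal, C < ⊤ ∧
      ∀ ℓ, ∫⁻ ω, (ξs ℓ ω (Set.Icc a b)) ^ k ∂P ≤ C) (f : C_c(ℝ, ℝ)) (p : ℕ) :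
    ∃ C : ℝ, 0 ≤ C ∧ ∀ ℓ, Integrable (fun ω => |linStat f (ξs ℓ ω)| ^ p) P ∧
      ∫ ω, |linStat f (ξs ℓ ω)| ^ p ∂P ≤ C := by
  obtain ⟨R, K, hK, hle⟩ := exists_abs_linStat_le f
  obtain ⟨C, hC, hbound⟩ := hmoms (-R) R p
  have hbd : ∀ ℓ, ∫⁻ ω, ENNReal.ofReal (|linStat f (ξs ℓ ω)| ^ p) ∂P
      ≤ ENNReal.ofReal (K ^ p) * C := by
    intro ℓ
    calc ∫⁻ ω, ENNReal.ofReal (|linStat f (ξs ℓ ω)| ^ p) ∂P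
        ≤ ∫⁻ ω, ENNReal.ofReal (K ^ p) * (ξs ℓ ω (Set.Icc (-R) R)) ^ p ∂P := by
          refine lintegral_mono_ae ?_
          filter_upwards [hpps ℓ] with ω hω
          rw [ENNReal.ofReal_pow (abs_nonneg _), ENNReal.ofReal_pow hK, ← mul_pow]
          gcongr
          refine (ENNReal.ofReal_le_ofReal (hle _ hω.1)).trans ?_
          rw [ENNReal.ofReal_mul hK]
          gcongr
          exact ENNReal.ofReal_toReal_le
      _ = ENNReal.ofReal (K ^ p) * ∫⁻ ω, (ξs ℓ ω (Set.Icc (-R) R)) ^ p ∂P :=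
          lintegral_const_mul' _ _ ENNReal.ofReal_ne_top
      _ ≤ _ := by gcongr; exact hbound ℓ
  have htop : ENNReal.ofReal (K ^ p) * C < ⊤ := ENNReal.mul_lt_top ENNReal.ofReal_lt_top hC
  refine ⟨(ENNReal.ofReal (K ^ p) * C).toReal, ENNReal.toReal_nonneg, fun ℓ => ?_⟩
  have hm : AEStronglyMeasurable (fun ω => |linStat f (ξs ℓ ω)| ^ p) P :=
    ((measurable_linStat f (hmeass ℓ)).norm.pow_const p).aestronglyMeasurable
  have h0 : 0 ≤ᵐ[P] fun ω => |linStat f (ξs ℓ ω)| ^ p := ae_of_all _ fun ω => by positivity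
  refine ⟨⟨hm, ?_⟩, ?_⟩
  · rw [hasFiniteIntegral_iff_ofReal h0]
    exact (hbd ℓ).trans_lt htop
  · rw [integral_eq_lintegral_of_nonneg_ae h0 hm]
    exact ENNReal.toReal_mono htop.ne (hbd ℓ)

lemma convInMean_comp_linStat [IsProbabilityMeasure P] (hmeas : Measurable ξ)
    (hmeass : ∀ ℓ, Measurable (ξs ℓ))
    (hdist : ConvInDist P ξs ξ) (f : C_c(ℝ, ℝ)) {g : ℝ → ℝ} (hg : Continuous g) {M : ℝ}
    (hM : ∀ x, |g x| ≤ M) : ConvInMean P ξs ξ fun μ => g (linStat f μ) := by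
  have hInt : ∀ η : Ω → Measure ℝ, Measurable η → Integrable (fun ω => g (linStat f (η ω))) P :=
    fun η hη => Integrable.of_bound
      (hg.measurable.comp (measurable_linStat f hη)).aestronglyMeasurable M
      (ae_of_all _ fun ω => hM _)
  exact ⟨fun ℓ => hInt _ (hmeass ℓ), hInt _ hmeas, hdist f f.continuous f.hasCompactSupport
    (BoundedContinuousFunction.ofNormedAddCommGroup g hg M hM)⟩

lemma integral_abs_linStat_pow_le_of_convInDist [IsProbabilityMeasure P] (hmeas : Measurable ξ)
    (hmeass : ∀ ℓ, Measurable (ξs ℓ)) (hdist : ConvInDist P ξs ξ) (f : C_c(ℝ, ℝ)) (p : ℕ) {C : ℝ}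
    (hC : ∀ ℓ, Integrable (fun ω => |linStat f (ξs ℓ ω)| ^ p) P ∧
      ∫ ω, |linStat f (ξs ℓ ω)| ^ p ∂P ≤ C) :
    Integrable (fun ω => |linStat f (ξ ω)| ^ p) P ∧ ∫ ω, |linStat f (ξ ω)| ^ p ∂P ≤ C := by
  have hconv : ∀ M : ℕ, ConvInMean P ξs ξ fun μ => min (M : ℝ) (|linStat f μ| ^ p) := fun M =>
    convInMean_comp_linStat hmeas hmeass hdist f (g := fun x => min (M : ℝ) (|x| ^ p)) (M := M)
      (by fun_prop) fun x => by
        rw [abs_of_nonneg (le_min (by positivity) (by positivity))]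
        exact min_le_left _ _
  have hle : ∀ M : ℕ, ∫ ω, min (M : ℝ) (|linStat f (ξ ω)| ^ p) ∂P ≤ C := fun M =>
    le_of_tendsto' (hconv M).2.2 fun ℓ =>
      (integral_mono ((hconv M).1 ℓ) (hC ℓ).1 fun ω => min_le_right _ _).trans (hC ℓ).2
  have hm : Measurable fun ω => |linStat f (ξ ω)| ^ p :=
    (measurable_linStat f hmeas).norm.pow_const p
  have h0 : 0 ≤ᵐ[P] fun ω => |linStat f (ξ ω)| ^ p := ae_of_all _ fun ω => by positivity
  have hlin : ∫⁻ ω, ENNReal.ofReal (|linStat f (ξ ω)| ^ p) ∂P ≤ ENNReal.ofReal C := by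
    have hlim : ∀ ω, liminf (fun M : ℕ => ENNReal.ofReal (min (M : ℝ) (|linStat f (ξ ω)| ^ p)))
        atTop = ENNReal.ofReal (|linStat f (ξ ω)| ^ p) := by
      intro ω
      refine Tendsto.liminf_eq (tendsto_const_nhds.congr' ?_)
      obtain ⟨M₀, hM₀⟩ := exists_nat_ge (|linStat f (ξ ω)| ^ p)
      filter_upwards [eventually_ge_atTop M₀] with M hM
      rw [min_eq_right (hM₀.trans (by exact_mod_cast hM))]
    simp_rw [← hlim]
    refine (lintegral_liminf_le fun M => (measurable_const.min hm).ennreal_ofReal).trans ?_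
    refine liminf_le_of_frequently_le' (Eventually.of_forall fun M => ?_).frequently
    rw [← ofReal_integral_eq_lintegral_ofReal (hconv M).2.1
      (ae_of_all _ fun ω => le_min (by positivity) (by positivity))]
    exact ENNReal.ofReal_le_ofReal (hle M)
  have hC0 : 0 ≤ C := (integral_nonneg fun ω => by positivity).trans (hC 0).2
  refine ⟨⟨hm.aestronglyMeasurable, ?_⟩, ?_⟩
  · rw [hasFiniteIntegral_iff_ofReal h0]
    exact hlin.trans_lt ENNReal.ofReal_lt_top
  · rw [integral_eq_lintegral_of_nonneg_ae h0 hm.aestronglyMeasurable]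
    exact ENNReal.toReal_le_of_le_ofReal hC0 hlin

lemma abs_sub_clamp_le {M : ℝ} (hM : 0 < M) (y : ℝ) :
    |y - max (-M) (min M y)| ≤ 1 / M * |y| ^ 2 := by
  rw [one_div, inv_mul_eq_div, le_div_iff₀ hM, sq_abs]
  rcases le_total y (-M) with h | h
  · rw [min_eq_right (by linarith), max_eq_left h, abs_of_nonpos (by linarith)]
    nlinarith
  rcases le_total M y with h' | h'
  · rw [min_eq_left h', max_eq_right (by linarith), abs_of_nonneg (by linarith)]
    nlinarith
  · rw [min_eq_right h', max_eq_right h]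
    simpa using sq_nonneg y

lemma convInMean_linStat_pow [IsProbabilityMeasure P] (hmeas : Measurable ξ)
    (hmeass : ∀ ℓ, Measurable (ξs ℓ))
    (hpp : ∀ᵐ ω ∂P, IsGoodMeasure (ξ ω)) (hpps : ∀ ℓ, ∀ᵐ ω ∂P, IsGoodMeasure (ξs ℓ ω))
    (hmoms : ∀ (a b : ℝ) (k : ℕ), ∃ C : ENNReal, C < ⊤ ∧
      ∀ ℓ, ∫⁻ ω, (ξs ℓ ω (Set.Icc a b)) ^ k ∂P ≤ C)
    (hdist : ConvInDist P ξs ξ) (f : C_c(ℝ, ℝ)) (n : ℕ) :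
    ConvInMean P ξs ξ fun μ => linStat f μ ^ n := by
  obtain ⟨C, hC0, hC⟩ := exists_integral_abs_linStat_pow_le hmeass hpps hmoms f (n * 2)
  refine ConvInMean.of_forall_approx (Ψ := fun μ => |linStat f μ| ^ (n * 2)) hpp hpps hC0 hC
    (integral_abs_linStat_pow_le_of_convInDist hmeas hmeass hdist f (n * 2) hC) fun ε hε => ?_
  refine ⟨fun μ => max (-(1 / ε)) (min (1 / ε) (linStat f μ ^ n)),
    convInMean_comp_linStat hmeas hmeass hdist f
      (g := fun x => max (-(1 / ε)) (min (1 / ε) (x ^ n))) (M := 1 / ε) (by fun_prop) fun x => ?_,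
    fun μ _ => ?_⟩
  · have : 0 < 1 / ε := by positivity
    exact abs_le.2 ⟨le_max_left _ _, max_le (by linarith) (min_le_left _ _)⟩
  · have := abs_sub_clamp_le (M := 1 / ε) (by positivity) (linStat f μ ^ n)
    rwa [one_div_one_div, abs_pow, ← pow_mul] at this

end Moments

lemma exists_pow_mul_eq_sum_pow (n : ℕ) : ∃ c : ℕ → ℝ, ∀ a b : ℝ,
    a ^ n * b = ∑ i ∈ Finset.range (n + 2), c i * (a + i * b) ^ (n + 1) := by
  refine ⟨fun i => (Lagrange.basis (Finset.range (n + 2)) (fun j : ℕ => (j : ℝ)) i).coeff 1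
    / (n + 1), fun a b => ?_⟩
  let p : Polynomial ℝ := (Polynomial.C b * Polynomial.X + Polynomial.C a) ^ (n + 1)
  have hdeg : p.degree < (Finset.range (n + 2)).card := by
    rw [Finset.card_range]
    refine (Polynomial.degree_pow_le _ _).trans_lt ?_
    refine (nsmul_le_nsmul_right Polynomial.degree_linear_le (n + 1)).trans_lt ?_
    rw [nsmul_one]
    exact_mod_cast Nat.lt_succ_self (n + 1)
  have hcoeff : p.coeff 1 = (n + 1) * (a ^ n * b) := by
    have h1 : p.coeff 1 = (Polynomial.derivative p).eval 0 := by
      rw [← Polynomial.coeff_zero_eq_eval_zero, Polynomial.coeff_derivative]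
      simp
    rw [h1]
    simp [p, Polynomial.derivative_pow]
    ring
  have hinterp := Lagrange.eq_interpolate (s := Finset.range (n + 2)) (v := fun j : ℕ => (j : ℝ))
    (Nat.cast_injective.injOn) hdeg
  have h2 := congrArg (fun q => Polynomial.coeff q 1) hinterp
  simp only [hcoeff, Lagrange.interpolate_apply, Polynomial.finsetSum_coeff,
    Polynomial.coeff_C_mul] at h2
  have hn : (n : ℝ) + 1 ≠ 0 := by positivity
  rw [← mul_right_inj' hn, h2, Finset.mul_sum]
  refine Finset.sum_congr rfl fun i _ => ?_
  simp only [p, Polynomial.eval_pow, Polynomial.eval_add, Polynomial.eval_mul,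
    Polynomial.eval_C, Polynomial.eval_X]
  field_simp
  ring

/-- A cutoff function equal to one on `[-R, R]`. -/
noncomputable def cutoff (R : ℝ) : C_c(ℝ, ℝ) where
  toFun x := max 0 (min 1 (R + 1 - |x|))
  continuous_toFun := by fun_prop
  hasCompactSupport' := by
    refine HasCompactSupport.intro (isCompact_Icc (a := -(R + 1)) (b := R + 1)) fun x hx => ?_
    rw [Set.mem_Icc, ← abs_le, not_le] at hx
    exact max_eq_left ((min_le_right _ _).trans (by linarith))

lemma cutoff_nonneg (R x : ℝ) : 0 ≤ cutoff R x := le_max_left _ _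

lemma cutoff_eq_one {R x : ℝ} (h : |x| ≤ R) : cutoff R x = 1 := by
  change max 0 (min 1 (R + 1 - |x|)) = 1
  rw [min_eq_left (by linarith), max_eq_right zero_le_one]

lemma cutoff_eq_zero {R x : ℝ} (h : R + 1 ≤ |x|) : cutoff R x = 0 :=
  max_eq_left ((min_le_right _ _).trans (by linarith))

/-- The monomial `x ^ n` times a cutoff function. -/
noncomputable def cutoffPow (R : ℝ) (n : ℕ) : C_c(ℝ, ℝ) where
  toFun x := x ^ n * cutoff R x
  continuous_toFun := (continuous_pow n).mul (cutoff R).continuous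
  hasCompactSupport' := (cutoff R).hasCompactSupport.mul_left

lemma exists_mvPolynomial_near {k : ℕ} {f : (Fin k → ℝ) → ℝ} (hf : Continuous f)
    {K : Set (Fin k → ℝ)} (hK : IsCompact K) {ε : ℝ} (hε : 0 < ε) :
    ∃ p : MvPolynomial (Fin k) ℝ, ∀ x ∈ K, |f x - MvPolynomial.eval x p| ≤ ε := by
  let φ : MvPolynomial (Fin k) ℝ →ₐ[ℝ] C(Fin k → ℝ, ℝ) :=
    MvPolynomial.aeval fun i => ⟨fun x => x i, continuous_apply i⟩
  have hφ : ∀ p x, φ p x = MvPolynomial.eval x p := by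
    intro p x
    induction p using MvPolynomial.induction_on with
    | C a => simp [φ]
    | add p q hp hq => simp [hp, hq]
    | mul_X p i hp => simp [hp]; simp [φ]
  have hsep : φ.range.SeparatesPoints := by
    intro x y hxy
    obtain ⟨i, hi⟩ := Function.ne_iff.1 hxy
    exact ⟨φ (MvPolynomial.X i), ⟨φ (MvPolynomial.X i), ⟨_, rfl⟩, rfl⟩, by simpa [hφ] using hi⟩
  obtain ⟨g, ⟨p, rfl⟩, hp⟩ :=
    ContinuousMap.exists_mem_subalgebra_near_continuous_of_isCompact_of_separatesPoints
      hsep ⟨f, hf⟩ hK hε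
  refine ⟨p, fun x hx => ?_⟩
  have := (hp x hx).le
  rw [norm_sub_rev] at this
  simpa [hφ] using this

lemma exists_tensorFun_near {k : ℕ} {f : (Fin k → ℝ) → ℝ} (hf : Continuous f)
    (hfc : HasCompactSupport f) : ∃ R : ℝ, ∀ ε > 0, ∃ p : MvPolynomial (Fin k) ℝ, ∀ x,
      |f x - ∑ s ∈ p.support, p.coeff s * tensorFun (fun i => cutoffPow R (s i)) x|
        ≤ ε * tensorFun (fun _ => cutoff R) x := by
  obtain ⟨R, hR⟩ := hfc.isCompact.isBounded.exists_norm_le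
  refine ⟨R, fun ε hε => ?_⟩
  obtain ⟨p, hp⟩ := exists_mvPolynomial_near hf
    (isCompact_univ_pi fun _ : Fin k => isCompact_Icc (a := -(R + 1)) (b := R + 1)) hε
  refine ⟨p, fun x => ?_⟩
  have hsum : ∑ s ∈ p.support, p.coeff s * tensorFun (fun i => cutoffPow R (s i)) x
      = MvPolynomial.eval x p * tensorFun (fun _ => cutoff R) x := by
    rw [MvPolynomial.eval_eq', Finset.sum_mul]
    refine Finset.sum_congr rfl fun s _ => ?_
    rw [mul_assoc]
    congr 1
    exact Finset.prod_mul_distrib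
  have hmul : f x = f x * tensorFun (fun _ => cutoff R) x := by
    by_cases h0 : f x = 0
    · simp [h0]
    · have : tensorFun (fun _ => cutoff R) x = 1 := Finset.prod_eq_one fun i _ =>
        cutoff_eq_one ((norm_le_pi_norm x i).trans (hR x (subset_tsupport f h0)))
      rw [this, mul_one]
  have hnonneg : 0 ≤ tensorFun (fun _ => cutoff R) x :=
    Finset.prod_nonneg fun i _ => cutoff_nonneg R _
  rw [hsum, hmul, ← sub_mul, abs_mul, abs_of_nonneg hnonneg]
  by_cases hx : ∃ i, R + 1 ≤ |x i|
  · obtain ⟨i, hi⟩ := hx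
    have : tensorFun (fun _ => cutoff R) x = 0 :=
      Finset.prod_eq_zero (Finset.mem_univ i) (cutoff_eq_zero hi)
    simp [this]
  · push Not at hx
    exact mul_le_mul_of_nonneg_right (hp x fun i _ => abs_le.1 (hx i).le) hnonneg

section Correlation

variable {Ω : Type*} [MeasurableSpace Ω] {P : Measure Ω}
  {ξs : ℕ → Ω → Measure ℝ} {ξ : Ω → Measure ℝ}

lemma convInMean_pow_mul_prod (hpp : ∀ᵐ ω ∂P, IsGoodMeasure (ξ ω))
    (hpps : ∀ ℓ, ∀ᵐ ω ∂P, IsGoodMeasure (ξs ℓ ω))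
    (hpow : ∀ f n, ConvInMean P ξs ξ fun μ => linStat f μ ^ n) (gs : List C_c(ℝ, ℝ)) :
    ∀ f n, ConvInMean P ξs ξ fun μ => linStat f μ ^ n * (gs.map fun g => linStat g μ).prod := by
  induction gs with
  | nil => simpa using hpow
  | cons g gs ih =>
    intro f n
    obtain ⟨c, hc⟩ := exists_pow_mul_eq_sum_pow n
    refine (ConvInMean.finsetSum (Finset.range (n + 2)) fun i _ =>
      (ih (f + (i : ℝ) • g) (n + 1)).const_mul (c i)).congr hpp hpps fun μ hμ => ?_
    simp_rw [linStat_add _ _ hμ, linStat_smul, List.map_cons, List.prod_cons, ← mul_assoc,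
      ← Finset.sum_mul, ← hc]

lemma convInMean_corrSumM_tensorFun_mul_prod (hpp : ∀ᵐ ω ∂P, IsGoodMeasure (ξ ω))
    (hpps : ∀ ℓ, ∀ᵐ ω ∂P, IsGoodMeasure (ξs ℓ ω))
    (hpow : ∀ f n, ConvInMean P ξs ξ fun μ => linStat f μ ^ n) (k : ℕ) :
    ∀ (f : Fin k → C_c(ℝ, ℝ)) (gs : List C_c(ℝ, ℝ)), ConvInMean P ξs ξ fun μ =>
      corrSumM μ k (tensorFun f) * (gs.map fun g => linStat g μ).prod := by
  induction k with
  | zero =>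
    intro f gs
    refine (convInMean_pow_mul_prod hpp hpps hpow gs 0 0).congr hpp hpps fun μ _ => ?_
    rw [corrSumM_tensorFun_zero, pow_zero]
  | succ k ih =>
    intro f gs
    refine ((ih (Fin.tail f) (f 0 :: gs)).sub (ConvInMean.finsetSum Finset.univ fun i _ =>
      ih (Function.update (Fin.tail f) i (Fin.tail f i * f 0)) gs)).congr hpp hpps fun μ hμ => ?_
    rw [hμ.corrSumM_tensorFun_succ, sub_mul, Finset.sum_mul, List.map_cons, List.prod_cons,
      mul_assoc]

lemma convInMean_corrSumM (hpp : ∀ᵐ ω ∂P, IsGoodMeasure (ξ ω))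
    (hpps : ∀ ℓ, ∀ᵐ ω ∂P, IsGoodMeasure (ξs ℓ ω))
    (hpow : ∀ f n, ConvInMean P ξs ξ fun μ => linStat f μ ^ n) {k : ℕ} {f : (Fin k → ℝ) → ℝ}
    (hf : Continuous f) (hfc : HasCompactSupport f) :
    ConvInMean P ξs ξ fun μ => corrSumM μ k f := by
  have htensor : ∀ h : Fin k → C_c(ℝ, ℝ), ConvInMean P ξs ξ fun μ =>
      corrSumM μ k (tensorFun h) := fun h => by
    simpa using convInMean_corrSumM_tensorFun_mul_prod hpp hpps hpow k h []
  obtain ⟨R, hR⟩ := exists_tensorFun_near hf hfc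
  have hu := htensor fun _ => cutoff R
  obtain ⟨C, hC⟩ := hu.2.2.bddAbove_range
  refine ConvInMean.of_forall_approx (Ψ := fun μ => corrSumM μ k (tensorFun fun _ => cutoff R))
    (C := max C 0) hpp hpps (le_max_right _ _)
    (fun ℓ => ⟨hu.1 ℓ, (hC ⟨ℓ, rfl⟩).trans (le_max_left _ _)⟩)
    ⟨hu.2.1, (le_of_tendsto' hu.2.2 fun ℓ => hC ⟨ℓ, rfl⟩).trans (le_max_left _ _)⟩ fun ε hε => ?_
  obtain ⟨p, hp⟩ := hR ε hε
  refine ⟨_, ConvInMean.finsetSum p.support fun s _ =>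
    (htensor fun i => cutoffPow R (s i)).const_mul (p.coeff s), fun μ hμ => ?_⟩
  rw [← hμ.corrSumM_sum _ _ _ fun s => hasCompactSupport_tensorFun _]
  refine hμ.abs_corrSumM_sub_le hfc ?_ (hasCompactSupport_tensorFun _) hp
  refine HasCompactSupport.intro (isCompact_univ_pi fun _ : Fin k =>
    isCompact_Icc (a := -(R + 1)) (b := R + 1)) fun x hx => Finset.sum_eq_zero fun s _ => ?_
  simp only [Set.mem_pi, Set.mem_univ, true_imp_iff, not_forall] at hx
  obtain ⟨i, hi⟩ := hx
  rw [Set.mem_Icc, ← abs_le, not_le] at hi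
  refine mul_eq_zero_of_right _ (Finset.prod_eq_zero (Finset.mem_univ i) ?_)
  exact mul_eq_zero_of_right _ (cutoff_eq_zero hi.le)

end Correlation

lemma linStat_cutoff_nonneg (R : ℝ) (μ : Measure ℝ) : 0 ≤ linStat (cutoff R) μ :=
  integral_nonneg (cutoff_nonneg R)

lemma IsPointMeasure.measure_Icc_le_ofReal_linStat {μ : Measure ℝ} (h : IsPointMeasure μ)
    {a b R : ℝ} (hR : ∀ x ∈ Set.Icc a b, |x| ≤ R) :
    μ (Set.Icc a b) ≤ ENNReal.ofReal (linStat (cutoff R) μ) := by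
  have := h.isLocallyFiniteMeasure
  have hi : Integrable (fun x => cutoff R x) μ :=
    (cutoff R).continuous.integrable_of_hasCompactSupport (cutoff R).hasCompactSupport
  rw [linStat, ofReal_integral_eq_lintegral_ofReal hi (ae_of_all _ (cutoff_nonneg R)),
    ← lintegral_indicator_one measurableSet_Icc]
  refine lintegral_mono fun x => ?_
  by_cases hx : x ∈ Set.Icc a b
  · simp [Set.indicator_of_mem hx, cutoff_eq_one (hR x hx)]
  · simp [Set.indicator_of_notMem hx]

/-- (Thm. `tail_bound_distributions`.) If the point processes `ξ_ℓ` have uniformly bounded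
moments of counts in compact intervals and converge in distribution to `ξ`, then `ξ` has all
moments finite and `ξ_ℓ` converges in correlation to `ξ`. -/
theorem stmt_6 {Ω : Type*} [MeasurableSpace Ω] (P : MeasureTheory.Measure Ω)
    [IsProbabilityMeasure P]
    (ξ : Ω → MeasureTheory.Measure ℝ) (ξs : ℕ → Ω → MeasureTheory.Measure ℝ)
    (hmeas : Measurable ξ) (hmeass : ∀ ℓ, Measurable (ξs ℓ))
    (hpp : ∀ᵐ ω ∂P, IsPointMeasure (ξ ω) ∧ InfiniteBothDirections (ξ ω))
    (hpps : ∀ ℓ, ∀ᵐ ω ∂P, IsPointMeasure (ξs ℓ ω) ∧ InfiniteBothDirections (ξs ℓ ω))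
    (hmoms : ∀ (a b : ℝ) (k : ℕ), ∃ C : ENNReal, C < ⊤ ∧
      ∀ ℓ, ∫⁻ ω, (ξs ℓ ω (Set.Icc a b)) ^ k ∂P ≤ C)
    (hdist : ConvInDist P ξs ξ) :
    (∀ (a b : ℝ) (k : ℕ), ∫⁻ ω, (ξ ω (Set.Icc a b)) ^ k ∂P < ⊤) ∧
    ConvInCorr P ξs ξ := by
  have hpow := convInMean_linStat_pow hmeas hmeass hpp hpps hmoms hdist
  refine ⟨fun a b k => ?_, fun k _ f hf hfc => (convInMean_corrSumM hpp hpps hpow hf hfc).2.2⟩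
  have hInt : Integrable (fun ω => linStat (cutoff (max |a| |b|)) (ξ ω) ^ k) P := (hpow _ k).2.1
  have hle : ∀ᵐ ω ∂P, (ξ ω (Set.Icc a b)) ^ k
      ≤ ENNReal.ofReal (linStat (cutoff (max |a| |b|)) (ξ ω) ^ k) := by
    filter_upwards [hpp] with ω hω
    rw [ENNReal.ofReal_pow (linStat_cutoff_nonneg _ _)]
    gcongr
    exact hω.1.measure_Icc_le_ofReal_linStat fun x hx => abs_le_max_abs_abs hx.1 hx.2
  refine (lintegral_mono_ae hle).trans_lt ?_
  rw [← hasFiniteIntegral_iff_ofReal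
    (ae_of_all _ fun ω => pow_nonneg (linStat_cutoff_nonneg _ _) k)]
  exact hInt.2
end

section
/- Let {c_n}_{n≥1} be any non-decreasing locally finite collection of positive points with c_n → ∞, and suppose N = N_c(T) := #{n : c_n ∈ (0,T]} ≥ 1 for all large T. Let ξ_T be the random measure Σ_{n≥1} δ_{c_n − t} with t chosen uniformly from (0,T], and let ξ̆_T be the random measure Σ_{n∈ℤ} δ_{c̆_n − t} with the same uniform t, where c̆_{m+rN} := c_m + r·T for 1 ≤ m ≤ N and r ∈ ℤ. Then for any point process ξ on ℝ: ξ_T converges in distribution to ξ as T → ∞ if and only if ξ̆_T converges in distribution to ξ as T → ∞. -/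
open MeasureTheory Filter Topology Bornology

/-- `N_c(T) = #{n ≥ 1 : c_n ∈ (0,T]}`. -/
noncomputable def Ncount (c : ℕ → ℝ) (T : ℝ) : ℕ :=
  Nat.card {n : ℕ | 1 ≤ n ∧ c n ∈ Set.Ioc (0 : ℝ) T}

/-- The periodized points `c̆_{m + rN} = c_m + r·T` for `1 ≤ m ≤ N`, `r ∈ ℤ`,
where `N = N_c(T)`: the points `c_1, ..., c_N` of `(0,T]` tessellated by translates of `T`. -/
noncomputable def cbr (c : ℕ → ℝ) (T : ℝ) (n : ℤ) : ℝ :=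
  c (((n - 1) % (Ncount c T : ℤ)).toNat + 1) + (((n - 1) / (Ncount c T : ℤ) : ℤ) : ℝ) * T

open Classical in
/-- The linear statistic `Σ_{n ≥ 1} f(c_n − t)` of the configuration `{c_n − t}_{n ≥ 1}`. -/
noncomputable def seqStat (c : ℕ → ℝ) (f : ℝ → ℝ) (t : ℝ) : ℝ :=
  ∑' n : ℕ, if 1 ≤ n then f (c n - t) else 0

/-- The linear statistic `Σ_{n ∈ ℤ} f(c̆_n − t)` of the periodized configuration. -/
noncomputable def brStat (c : ℕ → ℝ) (T : ℝ) (f : ℝ → ℝ) (t : ℝ) : ℝ :=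
  ∑' n : ℤ, f (cbr c T n - t)

theorem continuous_tsum_comp_sub {ι : Type*} {p : ι → ℝ} (hp : ∀ B : ℝ, {i | |p i| ≤ B}.Finite)
    {f : ℝ → ℝ} (hf : Continuous f) (hfc : HasCompactSupport f) :
    Continuous fun t => ∑' i, f (p i - t) := by
  obtain ⟨A, -, hA⟩ := hfc.exists_pos_le_norm
  have hloc : LocallyFinite fun i => Function.support fun t => f (p i - t) := by
    intro t
    refine ⟨Metric.ball t 1, Metric.ball_mem_nhds t one_pos,
      (hp (|t| + 1 + A)).subset ?_⟩
    rintro i ⟨s, hs, hst⟩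
    rw [Metric.mem_ball, Real.dist_eq] at hst
    have h : |p i - s| < A := by
      by_contra! h
      exact hs (hA _ h)
    have h1 := abs_add_le (p i - s) s
    have h2 := abs_add_le (s - t) t
    simp only [sub_add_cancel] at h1 h2
    rw [Set.mem_ofPred_eq]
    linarith
  have heq : (fun t => ∑' i, f (p i - t)) = fun t => ∑ᶠ i, f (p i - t) := by
    funext t
    exact tsum_eq_finsum (hloc.point_finite t)
  rw [heq]
  exact continuous_finsum (fun i => by fun_prop) hloc

theorem finite_setOf_abs_le {c : ℕ → ℝ} (htop : Tendsto c atTop atTop) (B : ℝ) :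
    {n : ℕ | |c n| ≤ B}.Finite := by
  obtain ⟨M, hM⟩ := eventually_atTop.1 (htop.eventually_gt_atTop B)
  refine (Set.finite_lt_nat M).subset fun n hn => ?_
  by_contra! h
  exact (hM n (not_lt.1 h)).not_ge ((le_abs_self _).trans hn)

theorem continuous_seqStat {c : ℕ → ℝ} (htop : Tendsto c atTop atTop) {f : ℝ → ℝ}
    (hf : Continuous f) (hfc : HasCompactSupport f) : Continuous (seqStat c f) := by
  have heq : seqStat c f = fun t => ∑' n : {n : ℕ | 1 ≤ n}, f (c n - t) := by
    funext t
    rw [tsum_subtype {n : ℕ | 1 ≤ n} fun n => f (c n - t)]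
    simp only [seqStat, Set.indicator_apply, Set.mem_ofPred_eq]
  rw [heq]
  refine continuous_tsum_comp_sub (fun B => ?_) hf hfc
  exact (finite_setOf_abs_le htop B).preimage Subtype.val_injective.injOn

theorem le_Ncount_iff {c : ℕ → ℝ} (hmono : Monotone c) (hpos : ∀ n : ℕ, 1 ≤ n → 0 < c n)
    (htop : Tendsto c atTop atTop) {T : ℝ} {n : ℕ} (hn : 1 ≤ n) :
    n ≤ Ncount c T ↔ c n ≤ T := by
  have hfin : {n : ℕ | 1 ≤ n ∧ c n ∈ Set.Ioc (0 : ℝ) T}.Finite := by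
    refine (finite_setOf_abs_le htop T).subset fun n hn => ?_
    simpa [abs_of_pos hn.2.1] using hn.2.2
  have hcard : Ncount c T = {n : ℕ | 1 ≤ n ∧ c n ∈ Set.Ioc (0 : ℝ) T}.ncard := rfl
  rw [hcard]
  constructor
  · intro h
    by_contra! hT
    have hsub : {n : ℕ | 1 ≤ n ∧ c n ∈ Set.Ioc (0 : ℝ) T} ⊆ (Finset.Icc 1 (n - 1) : Finset ℕ) := by
      intro m hm
      have : m < n := hmono.reflect_lt (hm.2.2.trans_lt hT)
      simp only [Finset.coe_Icc, Set.mem_Icc]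
      exact ⟨hm.1, by omega⟩
    have := Set.ncard_le_ncard hsub (Finset.finite_toSet _)
    rw [Set.ncard_coe_finset, Nat.card_Icc] at this
    omega
  · intro h
    have hsub : ((Finset.Icc 1 n : Finset ℕ) : Set ℕ) ⊆
        {n : ℕ | 1 ≤ n ∧ c n ∈ Set.Ioc (0 : ℝ) T} := by
      intro m hm
      simp only [Finset.coe_Icc, Set.mem_Icc] at hm
      exact ⟨hm.1, hpos m hm.1, (hmono hm.2).trans h⟩
    have := Set.ncard_le_ncard hsub hfin
    rw [Set.ncard_coe_finset, Nat.card_Icc] at this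
    omega

theorem cbr_mem_Ioc {c : ℕ → ℝ} (hmono : Monotone c) (hpos : ∀ n : ℕ, 1 ≤ n → 0 < c n)
    (htop : Tendsto c atTop atTop) {T : ℝ} (hN : 1 ≤ Ncount c T) (n : ℤ) :
    cbr c T n ∈ Set.Ioc ((((n - 1) / (Ncount c T : ℤ) : ℤ) : ℝ) * T)
      (T + (((n - 1) / (Ncount c T : ℤ) : ℤ) : ℝ) * T) := by
  have h0 := Int.emod_nonneg (n - 1) (b := (Ncount c T : ℤ)) (by omega)
  have h1 := Int.emod_lt_of_pos (n - 1) (b := (Ncount c T : ℤ)) (by omega)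
  have hle : ((n - 1) % (Ncount c T : ℤ)).toNat + 1 ≤ Ncount c T := by omega
  have hT := (le_Ncount_iff hmono hpos htop (Nat.le_add_left 1 _)).1 hle
  have h0 := hpos (((n - 1) % (Ncount c T : ℤ)).toNat + 1) (Nat.le_add_left 1 _)
  simp only [cbr, Set.mem_Ioc]
  constructor <;> linarith

theorem cbr_natCast {c : ℕ → ℝ} {T : ℝ} {n : ℕ} (hn : 1 ≤ n) (hnN : n ≤ Ncount c T) :
    cbr c T n = c n := by
  have hmod : ((n : ℤ) - 1) % (Ncount c T : ℤ) = n - 1 :=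
    Int.emod_eq_of_lt (by omega) (by omega)
  have hdiv : ((n : ℤ) - 1) / (Ncount c T : ℤ) = 0 :=
    Int.ediv_eq_zero_of_lt (by omega) (by omega)
  have hnat : ((n : ℤ) - 1).toNat + 1 = n := by omega
  rw [cbr, hmod, hdiv, hnat, Int.cast_zero, zero_mul, add_zero]

theorem cbr_nonpos {c : ℕ → ℝ} (hmono : Monotone c) (hpos : ∀ n : ℕ, 1 ≤ n → 0 < c n)
    (htop : Tendsto c atTop atTop) {T : ℝ} (hT : 0 < T) (hN : 1 ≤ Ncount c T) {n : ℤ}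
    (hn : n ≤ 0) : cbr c T n ≤ 0 := by
  have h := (cbr_mem_Ioc hmono hpos htop hN n).2
  have hr : (n - 1) / (Ncount c T : ℤ) ≤ -1 := by
    have := Int.ediv_neg_of_neg_of_pos (a := n - 1) (b := (Ncount c T : ℤ)) (by omega) (by omega)
    omega
  have hr' : (((n - 1) / (Ncount c T : ℤ) : ℤ) : ℝ) ≤ -1 := by exact_mod_cast hr
  nlinarith

theorem lt_cbr {c : ℕ → ℝ} (hmono : Monotone c) (hpos : ∀ n : ℕ, 1 ≤ n → 0 < c n)
    (htop : Tendsto c atTop atTop) {T : ℝ} (hT : 0 < T) (hN : 1 ≤ Ncount c T) {n : ℤ}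
    (hn : (Ncount c T : ℤ) < n) : T < cbr c T n := by
  have h := (cbr_mem_Ioc hmono hpos htop hN n).1
  have hr : 1 ≤ (n - 1) / (Ncount c T : ℤ) :=
    (Int.le_ediv_iff_mul_le (by omega)).2 (by omega)
  have hr' : (1 : ℝ) ≤ (((n - 1) / (Ncount c T : ℤ) : ℤ) : ℝ) := by exact_mod_cast hr
  nlinarith

theorem continuous_brStat {c : ℕ → ℝ} (hmono : Monotone c) (hpos : ∀ n : ℕ, 1 ≤ n → 0 < c n)
    (htop : Tendsto c atTop atTop) {T : ℝ} (hT : 0 < T) (hN : 1 ≤ Ncount c T) {f : ℝ → ℝ}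
    (hf : Continuous f) (hfc : HasCompactSupport f) : Continuous (brStat c T f) := by
  refine continuous_tsum_comp_sub (fun B => ?_) hf hfc
  obtain ⟨K, hK⟩ := exists_nat_ge (B / T)
  rw [div_le_iff₀ hT] at hK
  have hN' : (0 : ℤ) < Ncount c T := by omega
  refine (Set.finite_Icc (-((K : ℤ) + 1) * Ncount c T + 1)
    (((K : ℤ) + 1) * Ncount c T + 1)).subset fun n hn => ?_
  obtain ⟨h1, h2⟩ := cbr_mem_Ioc hmono hpos htop hN n
  obtain ⟨h3, h4⟩ := abs_le.1 (show |cbr c T n| ≤ B from hn)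
  set r : ℤ := (n - 1) / (Ncount c T : ℤ) with hr
  have hrK : r < K + 1 := by
    have : (r : ℝ) < K + 1 := by
      by_contra! h
      nlinarith
    exact_mod_cast this
  have hrK' : -((K : ℤ) + 1) ≤ r := by
    have : -((K : ℝ) + 1) ≤ r := by
      by_contra! h
      nlinarith
    exact_mod_cast this
  have hlt := (Int.ediv_lt_iff_lt_mul hN').1 hrK
  have hge := (Int.le_ediv_iff_mul_le hN').1 hrK'
  exact ⟨by linarith, by linarith⟩

/-- Away from the ends of `(0, T]`, a test function does not see the periodization. -/
theorem brStat_eq_seqStat {c : ℕ → ℝ} (hmono : Monotone c) (hpos : ∀ n : ℕ, 1 ≤ n → 0 < c n)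
    (htop : Tendsto c atTop atTop) {T : ℝ} (hT : 0 < T) (hN : 1 ≤ Ncount c T) {f : ℝ → ℝ}
    {A : ℝ} (hA : ∀ x : ℝ, A ≤ ‖x‖ → f x = 0) {t : ℝ} (hAt : A ≤ t) (htA : t ≤ T - A) :
    brStat c T f t = seqStat c f t := by
  have hleft : ∀ x ≤ 0, f (x - t) = 0 := fun x hx =>
    hA _ (by rw [Real.norm_eq_abs]; exact le_abs.2 (Or.inr (by linarith)))
  have hright : ∀ x, T < x → f (x - t) = 0 := fun x hx =>
    hA _ (by rw [Real.norm_eq_abs]; exact le_abs.2 (Or.inl (by linarith)))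
  have hsupp : (Function.support fun n : ℤ => f (cbr c T n - t)) ⊆
      Set.range ((↑) : ℕ → ℤ) := by
    intro n hn
    by_contra h
    have hneg : n ≤ 0 := by
      by_contra! hpos
      exact h ⟨n.toNat, by omega⟩
    exact hn (hleft _ (cbr_nonpos hmono hpos htop hT hN hneg))
  rw [brStat, ← Function.Injective.tsum_eq Nat.cast_injective hsupp, seqStat]
  refine tsum_congr fun n => ?_
  split_ifs with hn
  · by_cases hnN : n ≤ Ncount c T
    · rw [cbr_natCast hn hnN]
    · have hcn : T < c n := by
        by_contra! h
        exact hnN ((le_Ncount_iff hmono hpos htop hn).2 h)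
      rw [hright _ hcn, hright _ (lt_cbr hmono hpos htop hT hN (by omega))]
  · exact hleft _ (cbr_nonpos hmono hpos htop hT hN (by omega))

theorem norm_integral_le_of_eqOn_zero_middle {h : ℝ → ℝ} {A C T : ℝ} (hA : 0 ≤ A) (hT : 2 * A ≤ T)
    (hh : Continuous h) (hC : ∀ t, ‖h t‖ ≤ C) (h0 : ∀ t, A ≤ t → t ≤ T - A → h t = 0) :
    ‖∫ t in (0:ℝ)..T, h t‖ ≤ 2 * A * C := by
  have hmid : ∫ t in A..(T - A), h t = 0 := by
    rw [intervalIntegral.integral_congr (g := fun _ => 0), intervalIntegral.integral_zero]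
    intro t ht
    rw [Set.uIcc_of_le (by linarith)] at ht
    exact h0 t ht.1 ht.2
  rw [← intervalIntegral.integral_add_adjacent_intervals (hh.intervalIntegrable 0 A)
      (hh.intervalIntegrable A T),
    ← intervalIntegral.integral_add_adjacent_intervals (hh.intervalIntegrable A (T - A))
      (hh.intervalIntegrable (T - A) T), hmid, zero_add]
  have hl := intervalIntegral.norm_integral_le_of_norm_le_const (a := 0) (b := A) fun t _ => hC t
  have hr := intervalIntegral.norm_integral_le_of_norm_le_const (a := T - A) (b := T)
    fun t _ => hC t
  rw [show A - 0 = A by ring, abs_of_nonneg hA] at hl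
  rw [show T - (T - A) = A by ring, abs_of_nonneg hA] at hr
  linarith [norm_add_le (∫ t in (0:ℝ)..A, h t) (∫ t in (T - A)..T, h t)]

theorem tendsto_dist_average_seqStat_brStat {c : ℕ → ℝ} (hmono : Monotone c)
    (hpos : ∀ n : ℕ, 1 ≤ n → 0 < c n) (htop : Tendsto c atTop atTop)
    (hN : ∀ᶠ T in atTop, 1 ≤ Ncount c T) {f : ℝ → ℝ} (hf : Continuous f)
    (hfc : HasCompactSupport f) (g : BoundedContinuousFunction ℝ ℝ) :
    Tendsto (fun T => dist ((∫ t in (0:ℝ)..T, g (seqStat c f t)) / T)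
      ((∫ t in (0:ℝ)..T, g (brStat c T f t)) / T)) atTop (𝓝 0) := by
  obtain ⟨A, hA0, hA⟩ := hfc.exists_pos_le_norm
  refine squeeze_zero' (Eventually.of_forall fun _ => dist_nonneg) ?_
    ((tendsto_const_nhds (x := 2 * A * (‖g‖ + ‖g‖))).div_atTop tendsto_id)
  filter_upwards [hN, eventually_ge_atTop (2 * A)] with T hNT hAT
  have hT : 0 < T := by linarith
  have hs : Continuous fun t => g (seqStat c f t) :=
    g.continuous.comp (continuous_seqStat htop hf hfc)
  have hb : Continuous fun t => g (brStat c T f t) :=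
    g.continuous.comp (continuous_brStat hmono hpos htop hT hNT hf hfc)
  rw [dist_eq_norm, ← sub_div, norm_div, Real.norm_of_nonneg hT.le,
    ← intervalIntegral.integral_sub (hs.intervalIntegrable 0 T) (hb.intervalIntegrable 0 T)]
  refine div_le_div_of_nonneg_right
    (norm_integral_le_of_eqOn_zero_middle hA0.le hAT (hs.sub hb) (fun t => ?_) ?_) hT.le
  · exact (norm_sub_le _ _).trans (add_le_add (g.norm_coe_le_norm _) (g.norm_coe_le_norm _))
  · intro t h1 h2
    rw [brStat_eq_seqStat hmono hpos htop hT hNT hA h1 h2, sub_self]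

/-- (Prop. `xi_to_period`.) The point processes `ξ_T = {c_n − t}_{n≥1}` (with `t` uniform in
`(0,T]`) converge in distribution (sense of linear statistics) to a point process `ξ` iff the
periodized processes `ξ̆_T = {c̆_n − t}_{n∈ℤ}` do. -/
theorem stmt_13 {Ω : Type*} [MeasurableSpace Ω] (P : MeasureTheory.Measure Ω)
    [IsProbabilityMeasure P]
    (ξ : Ω → MeasureTheory.Measure ℝ) (hξ : Measurable ξ)
    (hpp : ∀ᵐ ω ∂P, IsPointMeasure (ξ ω))
    (c : ℕ → ℝ) (hmono : Monotone c) (hpos : ∀ n : ℕ, 1 ≤ n → 0 < c n)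
    (htop : Tendsto c atTop atTop)
    (hN : ∀ᶠ T in atTop, 1 ≤ Ncount c T) :
    (∀ f : ℝ → ℝ, Continuous f → HasCompactSupport f →
        ∀ g : BoundedContinuousFunction ℝ ℝ,
        Tendsto (fun T => (∫ t in (0:ℝ)..T, g (seqStat c f t)) / T) atTop
          (𝓝 (∫ ω, g (∫ x, f x ∂(ξ ω)) ∂P))) ↔
    (∀ f : ℝ → ℝ, Continuous f → HasCompactSupport f →
        ∀ g : BoundedContinuousFunction ℝ ℝ,
        Tendsto (fun T => (∫ t in (0:ℝ)..T, g (brStat c T f t)) / T) atTop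
          (𝓝 (∫ ω, g (∫ x, f x ∂(ξ ω)) ∂P))) := by
  have key := fun f hf hfc => tendsto_dist_average_seqStat_brStat hmono hpos htop hN
    (f := f) hf hfc
  exact forall₃_congr fun f hf hfc => forall_congr' fun g => tendsto_iff_of_dist (key f hf hfc g)
end

section
/- Let {c_n}_{n≥1} be a non-decreasing sequence of positive reals with N_c(T) := #{n : c_n ∈ (0,T]} satisfying N_c(T) ~ T as T → ∞. Let ξ_T be the random measure Σ_{n≥1} δ_{c_n − t} with t chosen uniformly from (0,T]; with N = N_c(T) and c̆_{m+rN} := c_m + r·T (1 ≤ m ≤ N, r ∈ ℤ), let Ξ̆_T be the random measure Σ_{j∈ℤ} δ_{c̆_j − c̆_n} with n chosen uniformly from {1,...,N}. Let ξ be a stationary point process on ℝ with intensity 1, and let ξ^0 be its Palm process. Then the following are equivalent: (i) ξ_T converges in distribution to ξ as T → ∞; (ii) Ξ̆_T converges in distribution to ξ^0 as T → ∞. -/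
open MeasureTheory Filter Topology Bornology

/-- The translation `θ^s ν` of a measure, with `θ^s ν (B) = ν (B + s)`. -/
noncomputable def translateMeasure (s : ℝ) (ν : MeasureTheory.Measure ℝ) :
    MeasureTheory.Measure ℝ :=
  ν.map (fun x => x - s)

/-- A random measure is stationary if all its translates have the same distribution. -/
def Stationary {Ω : Type*} [MeasurableSpace Ω] (P : MeasureTheory.Measure Ω)
    (ξ : Ω → MeasureTheory.Measure ℝ) : Prop :=
  ∀ s : ℝ, P.map (fun ω => translateMeasure s (ξ ω)) = P.map ξ

/-- A stationary point process has intensity `I` if `E[ξ(B)] = I · |B|` for Borel `B`. -/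
def HasIntensity {Ω : Type*} [MeasurableSpace Ω] (P : MeasureTheory.Measure Ω)
    (ξ : Ω → MeasureTheory.Measure ℝ) (I : ENNReal) : Prop :=
  ∀ B : Set ℝ, MeasurableSet B → ∫⁻ ω, ξ ω B ∂P = I * MeasureTheory.volume B

/-- `ξ0` (on `(Ω', P')`) is a Palm process of the stationary point process `ξ` (on `(Ω, P)`)
with intensity `I`: `P(ξ0 ∈ E) = I⁻¹ E[∫_(0,1] 1_E(θ^s ξ) dξ(s)]` for measurable `E`. -/
def IsPalmOf {Ω Ω' : Type*} [MeasurableSpace Ω] [MeasurableSpace Ω']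
    (P : MeasureTheory.Measure Ω) (ξ : Ω → MeasureTheory.Measure ℝ)
    (P' : MeasureTheory.Measure Ω') (ξ0 : Ω' → MeasureTheory.Measure ℝ)
    (I : ENNReal) : Prop :=
  ∀ E : Set (MeasureTheory.Measure ℝ), MeasurableSet E →
    P' {ω' | ξ0 ω' ∈ E} =
      I⁻¹ * ∫⁻ ω, (∫⁻ s in Set.Ioc (0 : ℝ) 1,
        E.indicator (fun _ => (1 : ENNReal)) (translateMeasure s (ξ ω)) ∂(ξ ω)) ∂P

/-- Continuous functions on the line with compact support. -/
structure IsTest (f : ℝ → ℝ) : Prop where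
  cont : Continuous f
  supp : HasCompactSupport f

namespace IsTest

lemma zero : IsTest 0 := ⟨continuous_zero, HasCompactSupport.zero⟩

lemma add_mul {f h : ℝ → ℝ} (hf : IsTest f) (hh : IsTest h) (b : ℝ) :
    IsTest (fun x => f x + b * h x) :=
  ⟨hf.cont.add (continuous_const.mul hh.cont), hf.supp.add hh.supp.mul_left⟩

lemma abs {f : ℝ → ℝ} (hf : IsTest f) : IsTest (fun x => |f x|) :=
  ⟨hf.cont.abs, hf.supp.comp_left (g := fun y : ℝ => |y|) abs_zero⟩

lemma translate {f : ℝ → ℝ} (hf : IsTest f) (u : ℝ) : IsTest (fun x => f (x + u)) :=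
  ⟨hf.cont.comp (continuous_add_const u), hf.supp.comp_homeomorph (Homeomorph.addRight u)⟩

lemma integrable {f : ℝ → ℝ} (hf : IsTest f) : Integrable f :=
  hf.cont.integrable_of_hasCompactSupport hf.supp

lemma exists_radius {f : ℝ → ℝ} (hf : IsTest f) : ∃ R > 0, ∀ x, R ≤ |x| → f x = 0 := by
  obtain ⟨R, hR, h⟩ := hf.supp.isBounded.exists_pos_norm_le
  refine ⟨R + 1, by linarith, fun x hx => ?_⟩
  by_contra hne
  have := h x (subset_tsupport f hne)
  rw [Real.norm_eq_abs] at this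
  linarith

lemma tent (r : ℝ) : IsTest (fun x => max 0 (min 1 (r + 1 - |x|))) := by
  refine ⟨by fun_prop, ?_⟩
  refine HasCompactSupport.of_support_subset_isCompact (isCompact_Icc (a := -(r + 1)) (b := r + 1)) ?_
  intro x hx
  rw [Set.mem_Icc, ← abs_le]
  by_contra h
  push Not at h
  apply hx
  simp only
  rw [max_eq_left]
  exact (min_le_right _ _).trans (by linarith)

/-- Small translations of a test function change it by a small multiple of a fixed test function,
uniformly over bounded translations of the latter. -/
lemma exists_modulus {f h : ℝ → ℝ} (hf : IsTest f) (hh : IsTest h) (hh0 : ∀ x, 0 ≤ h x) :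
    ∃ k, IsTest k ∧ (∀ x, h x ≤ k x) ∧ ∀ η > 0, ∃ δ > 0, ∀ u, |u| ≤ δ → ∀ v, |v| ≤ 1 → ∀ x,
      |f (x + u) - f x| ≤ η * k (x + v) := by
  obtain ⟨R, hR, hfR⟩ := hf.exists_radius
  refine ⟨fun x => max 0 (min 1 (R + 2 + 1 - |x|)) + 1 * h x, (tent (R + 2)).add_mul hh 1, ?_, ?_⟩
  · intro x
    have := le_max_left (0 : ℝ) (min 1 (R + 2 + 1 - |x|))
    linarith
  intro η hη
  have huc := hf.supp.uniformContinuous_of_continuous hf.cont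
  obtain ⟨δ, hδ, hd⟩ := Metric.uniformContinuous_iff.1 huc η hη
  refine ⟨min (δ / 2) 1, by positivity, fun u hu v hv x => ?_⟩
  have hu1 : |u| < δ := by
    have := hu.trans (min_le_left _ _)
    linarith
  have hu2 : |u| ≤ 1 := hu.trans (min_le_right _ _)
  by_cases hx : |x| < R + 1
  · have h1 : |f (x + u) - f x| < η := by
      have := @hd (x + u) x (by rw [Real.dist_eq]; simpa using hu1)
      rwa [Real.dist_eq] at this
    have h2 : max 0 (min 1 (R + 2 + 1 - |x + v|)) = 1 := by
      have := abs_add_le x v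
      rw [min_eq_left (by linarith), max_eq_right zero_le_one]
    have h3 := hh0 (x + v)
    have h4 : 0 ≤ η * h (x + v) := mul_nonneg hη.le h3
    simp only [h2]
    linarith
  · push Not at hx
    have h1 : f x = 0 := hfR x (by linarith)
    have h2 : f (x + u) = 0 := hfR _ (by
      have := abs_sub_abs_le_abs_sub x (-u)
      rw [abs_neg, sub_neg_eq_add] at this
      linarith)
    have h3 := hh0 (x + v)
    have h4 := le_max_left (0 : ℝ) (min 1 (R + 2 + 1 - |x + v|))
    rw [h1, h2]
    simp only [sub_zero, abs_zero, one_mul]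
    positivity

end IsTest

/-- Positivity and linearity of a functional on test functions, in one inequality. -/
def IsPosLin (L : (ℝ → ℝ) → ℝ) : Prop :=
  ∀ f f' k, IsTest f → IsTest f' → IsTest k → ∀ b : ℝ,
    (∀ x, f' x ≤ f x + b * k x) → L f' ≤ L f + b * L k

namespace IsPosLin

variable {L : (ℝ → ℝ) → ℝ}

lemma nonneg (hL : IsPosLin L) {h : ℝ → ℝ} (hh : IsTest h) (h0 : ∀ x, 0 ≤ h x) : 0 ≤ L h := by
  have h1 := hL 0 0 0 .zero .zero .zero 1 (by simp)
  have h2 := hL h 0 0 hh .zero .zero 0 (by simpa using h0)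
  linarith

lemma mono (hL : IsPosLin L) {f h : ℝ → ℝ} (hf : IsTest f) (hh : IsTest h)
    (hfh : ∀ x, f x ≤ h x) : L f ≤ L h := by
  have h2 := hL h f 0 hh hf .zero 0 (by simpa using hfh)
  linarith

lemma add_mul (hL : IsPosLin L) {f h : ℝ → ℝ} (hf : IsTest f) (hh : IsTest h) (b : ℝ) :
    L (fun x => f x + b * h x) = L f + b * L h := by
  have h1 := hL f _ h hf (hf.add_mul hh b) hh b (fun x => le_rfl)
  have h2 := hL _ f h (hf.add_mul hh b) hf hh (-b) (fun x => by simp)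
  linarith

lemma abs_sub_le (hL : IsPosLin L) {f f' k : ℝ → ℝ} (hf : IsTest f) (hf' : IsTest f')
    (hk : IsTest k) {b : ℝ} (h : ∀ x, |f' x - f x| ≤ b * k x) : |L f' - L f| ≤ b * L k := by
  have h1 := hL f f' k hf hf' hk b (fun x => by linarith [(abs_le.1 (h x)).2])
  have h2 := hL f' f k hf' hf hk b (fun x => by linarith [(abs_le.1 (h x)).1])
  rw [abs_le]
  constructor <;> linarith

end IsPosLin

/-- A random positive functional `X` on test functions, together with its Palm version `X₀`,
related by the refined Campbell formula with intensity `lam`. -/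
structure PalmPair {A B : Type*} [MeasurableSpace A] [MeasurableSpace B] (m : Measure A)
    (m₀ : Measure B) (X : A → (ℝ → ℝ) → ℝ) (X₀ : B → (ℝ → ℝ) → ℝ) (lam : ℝ) : Prop where
  prob : IsProbabilityMeasure m
  prob₀ : IsProbabilityMeasure m₀
  lam_nonneg : 0 ≤ lam
  integrable : ∀ f, IsTest f → Integrable (fun a => X a f) m
  aesm₀ : ∀ f, IsTest f → AEStronglyMeasurable (fun b => X₀ b f) m₀
  posLin : ∀ᵐ a ∂m, IsPosLin (X a)
  posLin₀ : ∀ᵐ b ∂m₀, IsPosLin (X₀ b)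
  campbell : ∀ h f, IsTest h → IsTest f → ∀ k : BoundedContinuousFunction ℝ ℝ,
    ∫ a, X a h * k (X a f) ∂m = lam * ∫ u, h u * ∫ b, k (X₀ b (fun x => f (x + u))) ∂m₀

lemma tendsto_of_forall_approx {a : ℕ → ℝ} {a' : ℝ}
    (h : ∀ ε > 0, ∃ (b : ℕ → ℝ) (b' : ℝ), Tendsto b atTop (𝓝 b') ∧
      (∀ᶠ n in atTop, |a n - b n| ≤ ε) ∧ |a' - b'| ≤ ε) : Tendsto a atTop (𝓝 a') := by
  rw [Metric.tendsto_nhds]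
  intro ε hε
  obtain ⟨b, b', hb, h1, h2⟩ := h (ε / 4) (by positivity)
  filter_upwards [h1, Metric.tendsto_nhds.1 hb (ε / 4) (by positivity)] with n h3 h4
  rw [Real.dist_eq] at h4 ⊢
  have e : a n - a' = (a n - b n) + (b n - b') - (a' - b') := by ring
  rw [e]
  have := abs_sub ((a n - b n) + (b n - b')) (a' - b')
  have := abs_add_le (a n - b n) (b n - b')
  linarith

/-- The function `x ↦ max 0 (min 1 (η x))`. -/
noncomputable def clampFun (η : ℝ) : BoundedContinuousFunction ℝ ℝ :=
  BoundedContinuousFunction.ofNormedAddCommGroup (fun x => max 0 (min 1 (η * x))) (by fun_prop) 1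
    (fun x => by
      rw [Real.norm_eq_abs, abs_of_nonneg (le_max_left _ _)]
      exact max_le zero_le_one (min_le_left _ _))

lemma clampFun_apply (η x : ℝ) : clampFun η x = max 0 (min 1 (η * x)) := rfl

lemma clampFun_nonneg (η x : ℝ) : 0 ≤ clampFun η x := le_max_left _ _

lemma clampFun_le_one (η x : ℝ) : clampFun η x ≤ 1 := max_le zero_le_one (min_le_left _ _)

/-- The bounded function `x ↦ x (1 - clampFun η x)` on the nonnegative half-line. -/
noncomputable def truncFun (η : ℝ) (hη : 0 < η) : BoundedContinuousFunction ℝ ℝ :=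
  BoundedContinuousFunction.ofNormedAddCommGroup (fun x => max 0 x * max 0 (1 - η * x))
    (by fun_prop) (1 / η) (fun x => by
      rw [Real.norm_eq_abs, abs_of_nonneg (by positivity)]
      rcases le_or_gt x 0 with h | h
      · rw [max_eq_left h, zero_mul]
        positivity
      rcases le_or_gt (1 - η * x) 0 with h' | h'
      · rw [max_eq_left h', mul_zero]
        positivity
      · rw [max_eq_right h.le, max_eq_right h'.le, le_div_iff₀ hη]
        nlinarith [mul_pos hη h])

lemma truncFun_eq {η x : ℝ} (hη : 0 < η) (hx : 0 ≤ x) :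
    truncFun η hη x = x - x * clampFun η x := by
  change max 0 x * max 0 (1 - η * x) = x - x * max 0 (min 1 (η * x))
  rw [max_eq_right hx]
  have : 0 ≤ η * x := by positivity
  rcases le_total 1 (η * x) with h | h
  · rw [min_eq_left h, max_eq_right zero_le_one, max_eq_left (by linarith)]
    ring
  · rw [min_eq_right h, max_eq_right this, max_eq_right (by linarith)]
    ring

namespace PalmPair

variable {A B : Type*} [MeasurableSpace A] [MeasurableSpace B] {m : Measure A}
    {m₀ : Measure B} {X : A → (ℝ → ℝ) → ℝ} {X₀ : B → (ℝ → ℝ) → ℝ} {lam : ℝ}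

lemma integrable_mul (hP : PalmPair m m₀ X X₀ lam) {h f : ℝ → ℝ} (hh : IsTest h) (hf : IsTest f)
    (k : BoundedContinuousFunction ℝ ℝ) : Integrable (fun a => X a h * k (X a f)) m := by
  refine (hP.integrable h hh).mul_bdd (c := ‖k‖) ?_ ?_
  · exact k.continuous.comp_aestronglyMeasurable (hP.integrable f hf).1
  · exact .of_forall fun a => k.norm_coe_le_norm _

lemma integrable_comp (hP : PalmPair m m₀ X X₀ lam) {f : ℝ → ℝ} (hf : IsTest f)
    (k : BoundedContinuousFunction ℝ ℝ) : Integrable (fun a => k (X a f)) m := by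
  have := hP.prob
  exact .of_bound (k.continuous.comp_aestronglyMeasurable (hP.integrable f hf).1) ‖k‖
    (.of_forall fun a => k.norm_coe_le_norm _)

lemma integrable_comp₀ (hP : PalmPair m m₀ X X₀ lam) {f : ℝ → ℝ} (hf : IsTest f)
    (k : BoundedContinuousFunction ℝ ℝ) : Integrable (fun a => k (X₀ a f)) m₀ := by
  have := hP.prob₀
  exact .of_bound (k.continuous.comp_aestronglyMeasurable (hP.aesm₀ f hf)) ‖k‖
    (.of_forall fun a => k.norm_coe_le_norm _)

lemma norm_integral_comp₀_le (hP : PalmPair m m₀ X X₀ lam) (f : ℝ → ℝ)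
    (k : BoundedContinuousFunction ℝ ℝ) : ‖∫ b, k (X₀ b f) ∂m₀‖ ≤ ‖k‖ := by
  have := hP.prob₀
  simpa using norm_integral_le_of_norm_le_const (μ := m₀) (f := fun b => k (X₀ b f)) (C := ‖k‖)
    (.of_forall fun a => k.norm_coe_le_norm _)

lemma integral_eq (hP : PalmPair m m₀ X X₀ lam) {h : ℝ → ℝ} (hh : IsTest h) :
    ∫ a, X a h ∂m = lam * ∫ u, h u := by
  have := hP.prob₀
  simpa using hP.campbell h h hh hh (BoundedContinuousFunction.const ℝ 1)

lemma continuous_translate (hP : PalmPair m m₀ X X₀ lam) {f : ℝ → ℝ} (hf : IsTest f)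
    (k : BoundedContinuousFunction ℝ ℝ) :
    Continuous (fun u => ∫ b, k (X₀ b (fun x => f (x + u))) ∂m₀) := by
  have := hP.prob₀
  refine continuous_of_dominated (bound := fun _ => ‖k‖) (fun u => ?_) (fun u => ?_)
    (integrable_const _) ?_
  · exact k.continuous.comp_aestronglyMeasurable (hP.aesm₀ _ (hf.translate u))
  · exact .of_forall fun a => k.norm_coe_le_norm _
  · filter_upwards [hP.posLin₀] with b hb
    refine k.continuous.comp ?_
    rw [continuous_iff_continuousAt]
    intro u₀
    obtain ⟨q, hq, hq0, H⟩ := (hf.translate u₀).exists_modulus IsTest.zero (fun _ => le_rfl)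
    have hq' := hb.nonneg hq hq0
    rw [Metric.continuousAt_iff]
    intro ε hε
    obtain ⟨δ, hδ, Hδ⟩ := H (ε / (X₀ b q + 1)) (by positivity)
    refine ⟨δ, hδ, fun u hu => ?_⟩
    rw [Real.dist_eq] at hu ⊢
    have h1 := hb.abs_sub_le (hf.translate u₀) (hf.translate u) hq (b := ε / (X₀ b q + 1))
      (fun x => by
        have := Hδ (u - u₀) hu.le 0 (by simp) x
        simpa [add_assoc] using this)
    refine h1.trans_lt ?_
    rw [div_mul_eq_mul_div, div_lt_iff₀ (by positivity)]
    nlinarith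

lemma integrable_translate (hP : PalmPair m m₀ X X₀ lam) {h f : ℝ → ℝ} (hh : IsTest h)
    (hf : IsTest f) (k : BoundedContinuousFunction ℝ ℝ) :
    Integrable (fun u => h u * ∫ b, k (X₀ b (fun x => f (x + u))) ∂m₀) := by
  refine hh.integrable.mul_bdd (c := ‖k‖) (hP.continuous_translate hf k).aestronglyMeasurable ?_
  exact .of_forall fun u => hP.norm_integral_comp₀_le _ _

lemma exists_integral_mul_clampFun_lt (hP : PalmPair m m₀ X X₀ lam) {h : ℝ → ℝ} (hh : IsTest h)
    {ε : ℝ} (hε : 0 < ε) :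
    ∃ η > 0, ∫ a, X a h * clampFun η (X a h) ∂m < ε := by
  have key : Tendsto (fun n : ℕ => ∫ a, X a h * clampFun (1 / ((n : ℝ) + 1)) (X a h) ∂m) atTop
      (𝓝 (∫ a, (0 : ℝ) ∂m)) := by
    refine tendsto_integral_of_dominated_convergence (fun a => |X a h|) ?_ ?_ ?_ ?_
    · exact fun n => (hP.integrable_mul hh hh _).1
    · exact (hP.integrable h hh).abs
    · refine fun n => .of_forall fun a => ?_
      rw [norm_mul, Real.norm_eq_abs, Real.norm_eq_abs, abs_of_nonneg (clampFun_nonneg _ _)]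
      exact mul_le_of_le_one_right (abs_nonneg _) (clampFun_le_one _ _)
    · refine .of_forall fun a => ?_
      have h1 : Tendsto (fun n : ℕ => 1 / ((n : ℝ) + 1)) atTop (𝓝 0) :=
        tendsto_one_div_add_atTop_nhds_zero_nat
      have h2 : Continuous (fun η : ℝ => X a h * max 0 (min 1 (η * X a h))) := by fun_prop
      have h3 := (h2.tendsto 0).comp h1
      simpa [clampFun_apply, Function.comp_def] using h3
  rw [integral_zero] at key
  obtain ⟨n, hn⟩ := (key.eventually_lt_const hε).exists
  exact ⟨_, by positivity, hn⟩

lemma integral_mul_clampFun (hP : PalmPair m m₀ X X₀ lam) {h : ℝ → ℝ} (hh : IsTest h)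
    (h0 : ∀ x, 0 ≤ h x) {η : ℝ} (hη : 0 < η) :
    ∫ a, X a h * clampFun η (X a h) ∂m =
      lam * (∫ u, h u) - ∫ a, truncFun η hη (X a h) ∂m := by
  rw [← hP.integral_eq hh, ← integral_sub (hP.integrable h hh) (hP.integrable_comp hh _)]
  refine integral_congr_ae ?_
  filter_upwards [hP.posLin] with a ha
  simp only [truncFun_eq hη (ha.nonneg hh h0)]
  ring

end PalmPair

/-- The quotient of `g - g 0` by the identity, regularised below scale `δ`. -/
noncomputable def regQuot (g : BoundedContinuousFunction ℝ ℝ) (δ : ℝ) (hδ : 0 < δ) :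
    BoundedContinuousFunction ℝ ℝ :=
  BoundedContinuousFunction.ofNormedAddCommGroup
    (fun x => (g x - g 0) * (x / (max |x| δ) ^ 2))
    (by
      have : ∀ x : ℝ, (max |x| δ) ^ 2 ≠ 0 := fun x => by positivity
      have hg := g.continuous
      fun_prop (disch := assumption))
    (2 * ‖g‖ * (1 / δ)) (fun x => by
      rw [norm_mul]
      gcongr
      · calc ‖g x - g 0‖ ≤ ‖g x‖ + ‖g 0‖ := norm_sub_le _ _
          _ ≤ 2 * ‖g‖ := by linarith [g.norm_coe_le_norm x, g.norm_coe_le_norm 0]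
      · rw [norm_div, Real.norm_eq_abs, Real.norm_eq_abs, abs_of_nonneg (sq_nonneg (max |x| δ)),
          div_le_div_iff₀ (by positivity) hδ]
        have h1 := le_max_left |x| δ
        have h2 := le_max_right |x| δ
        have h3 := abs_nonneg x
        nlinarith)

lemma abs_sub_regQuot_le {g : BoundedContinuousFunction ℝ ℝ} {δ ε : ℝ} (hδ : 0 < δ) (hε : 0 ≤ ε)
    (h : ∀ x, |x| ≤ δ → |g x - g 0| ≤ ε) (x : ℝ) :
    |g x - (g 0 + x * regQuot g δ hδ x)| ≤ ε := by
  change |g x - (g 0 + x * ((g x - g 0) * (x / (max |x| δ) ^ 2)))| ≤ ε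
  have e : g x - (g 0 + x * ((g x - g 0) * (x / (max |x| δ) ^ 2))) =
      (g x - g 0) * (1 - x ^ 2 / (max |x| δ) ^ 2) := by ring
  rw [e, abs_mul]
  rcases le_total |x| δ with hx | hx
  · rw [max_eq_right hx]
    have h1 : x ^ 2 / δ ^ 2 ≤ 1 := by
      rw [div_le_one (by positivity), ← sq_abs]
      gcongr
    have h2 : 0 ≤ x ^ 2 / δ ^ 2 := by positivity
    have h3 : |1 - x ^ 2 / δ ^ 2| ≤ 1 := by rw [abs_le]; constructor <;> linarith
    calc _ ≤ ε * 1 := by gcongr; exact h x hx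
      _ = ε := mul_one _
  · rw [max_eq_left hx, sq_abs, div_self (by
      have : 0 < |x| := hδ.trans_le hx
      have := abs_pos.1 this
      positivity)]
    simpa using hε

lemma abs_slope_sub_le {g G : BoundedContinuousFunction ℝ ℝ} (hG : ∀ x, HasDerivAt G (g x) x)
    {M : ℝ} (hM : ∀ x y, |g x - g y| ≤ M * |x - y|) (hM' : 2 * ‖g‖ ≤ M) {a : ℝ} (ha : 0 < a)
    {x y : ℝ} (hy : 0 ≤ y) :
    |(G (x + a * y) - G x) / a - y * g x| ≤ M * (y * clampFun a y) := by
  have hM0 : 0 ≤ M := (by positivity : 0 ≤ 2 * ‖g‖).trans hM'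
  have hay : 0 ≤ a * y := by positivity
  have key := Convex.norm_image_sub_le_of_norm_hasDerivWithin_le
    (f := fun t => G t - t * g x) (f' := fun t => g t - 1 * g x) (C := M * clampFun a y)
    (s := Set.Icc x (x + a * y)) (x := x) (y := x + a * y)
    (fun t _ => ((hG t).sub ((hasDerivAt_id t).mul_const (g x))).hasDerivWithinAt)
    (fun t ht => by
      rw [one_mul, Real.norm_eq_abs, clampFun_apply]
      have h1 : |g t - g x| ≤ M := by
        have := norm_sub_le (g t) (g x)
        rw [← Real.norm_eq_abs]
        linarith [g.norm_coe_le_norm t, g.norm_coe_le_norm x]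
      have h2 : |g t - g x| ≤ M * (a * y) := (hM t x).trans (by
        gcongr
        rw [abs_of_nonneg (by linarith [ht.1])]
        linarith [ht.2])
      rw [max_eq_right (le_min zero_le_one hay)]
      rcases le_total 1 (a * y) with h | h
      · rwa [min_eq_left h, mul_one]
      · rwa [min_eq_right h])
    (convex_Icc _ _) (by simp [hay]) (by simp [hay])
  have e : (G (x + a * y) - G x) / a - y * g x =
      (G (x + a * y) - (x + a * y) * g x - (G x - x * g x)) / a := by
    field_simp
    ring
  rw [e, abs_div, abs_of_pos ha, div_le_iff₀ ha, ← Real.norm_eq_abs]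
  refine key.trans (le_of_eq ?_)
  rw [add_sub_cancel_left, Real.norm_eq_abs, abs_of_nonneg hay]
  ring

lemma exists_bump {δ : ℝ} (hδ : 0 < δ) : ∃ h, IsTest h ∧ (∀ x, 0 ≤ h x) ∧ ∫ x, h x = 1 ∧
    ∀ x, δ ≤ |x| → h x = 0 := by
  let φ : ContDiffBump (0 : ℝ) := ⟨δ / 2, δ, by positivity, by linarith⟩
  refine ⟨φ.normed volume, ⟨φ.continuous_normed, φ.hasCompactSupport_normed⟩, φ.nonneg_normed,
    φ.integral_normed, fun x hx => ?_⟩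
  by_contra hne
  have : x ∈ Function.support (φ.normed volume) := hne
  rw [φ.support_normed_eq] at this
  simp only [Metric.mem_ball, dist_zero_right, Real.norm_eq_abs] at this
  have : |x| < δ := this
  linarith

namespace PalmPair

section single

variable {A B : Type*} [MeasurableSpace A] [MeasurableSpace B] {m : Measure A}
    {m₀ : Measure B} {X : A → (ℝ → ℝ) → ℝ} {X₀ : B → (ℝ → ℝ) → ℝ} {lam : ℝ}

lemma abs_integral_sub_regQuot_le (hP : PalmPair m m₀ X X₀ lam) {f : ℝ → ℝ} (hf : IsTest f)
    {g : BoundedContinuousFunction ℝ ℝ} {δ ε : ℝ} (hδ : 0 < δ) (hε : 0 ≤ ε)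
    (h : ∀ x, |x| ≤ δ → |g x - g 0| ≤ ε) :
    |∫ a, g (X a f) ∂m - (g 0 + ∫ a, X a f * regQuot g δ hδ (X a f) ∂m)| ≤ ε := by
  have := hP.prob
  have e : g 0 + ∫ a, X a f * regQuot g δ hδ (X a f) ∂m =
      ∫ a, (g 0 + X a f * regQuot g δ hδ (X a f)) ∂m := by
    rw [integral_add (integrable_const _) (hP.integrable_mul hf hf _)]
    simp
  have hi : Integrable (fun a => g 0 + X a f * regQuot g δ hδ (X a f)) m :=
    (integrable_const _).add (hP.integrable_mul hf hf _)
  rw [e, ← integral_sub (hP.integrable_comp hf g) hi, ← Real.norm_eq_abs]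
  simpa using norm_integral_le_of_norm_le_const (μ := m) (C := ε)
    (f := fun a => g (X a f) - (g 0 + X a f * regQuot g δ hδ (X a f)))
    (.of_forall fun a => abs_sub_regQuot_le hδ hε h _)

lemma abs_integral_mul_sub_slope_le (hP : PalmPair m m₀ X X₀ lam) {f h : ℝ → ℝ} (hf : IsTest f)
    (hh : IsTest h) (h0 : ∀ x, 0 ≤ h x)
    {g G : BoundedContinuousFunction ℝ ℝ} (hG : ∀ x, HasDerivAt G (g x) x)
    {M : ℝ} (hM : ∀ x y, |g x - g y| ≤ M * |x - y|) (hM' : 2 * ‖g‖ ≤ M) {a : ℝ} (ha : 0 < a) :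
    |∫ ω, X ω h * g (X ω f) ∂m -
      (∫ ω, G (X ω (fun x => f x + a * h x)) ∂m - ∫ ω, G (X ω f) ∂m) / a| ≤
      M * ∫ ω, X ω h * clampFun a (X ω h) ∂m := by
  have hi : Integrable (fun ω => (G (X ω (fun x => f x + a * h x)) - G (X ω f)) / a) m :=
    ((hP.integrable_comp (hf.add_mul hh a) G).sub (hP.integrable_comp hf G)).div_const a
  rw [← integral_sub (hP.integrable_comp (hf.add_mul hh a) G) (hP.integrable_comp hf G),
    ← integral_div, ← integral_sub (hP.integrable_mul hh hf g) hi, ← integral_const_mul, ← Real.norm_eq_abs]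
  refine norm_integral_le_of_norm_le ((hP.integrable_mul hh hh _).const_mul M) ?_
  filter_upwards [hP.posLin] with ω hω
  rw [hω.add_mul hf hh, Real.norm_eq_abs, abs_sub_comm]
  exact abs_slope_sub_le hG hM hM' ha (hω.nonneg hh h0)

lemma abs_comp₀_translate_sub_le (hP : PalmPair m m₀ X X₀ lam) {f f' k : ℝ → ℝ} (hf : IsTest f)
    (hf' : IsTest f') (hk : IsTest k) (hk0 : ∀ x, 0 ≤ k x) {g : BoundedContinuousFunction ℝ ℝ}
    {M : ℝ} (hM : ∀ x y, |g x - g y| ≤ M * |x - y|) (hM' : 2 * ‖g‖ ≤ M) {η : ℝ} (hη : 0 < η)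
    (h : ∀ x, |f' x - f x| ≤ η * k x) :
    |∫ b, g (X₀ b f') ∂m₀ - ∫ b, g (X₀ b f) ∂m₀| ≤ M * ∫ b, clampFun η (X₀ b k) ∂m₀ := by
  have hM0 : 0 ≤ M := (by positivity : 0 ≤ 2 * ‖g‖).trans hM'
  rw [← integral_sub (hP.integrable_comp₀ hf' g) (hP.integrable_comp₀ hf g),
    ← integral_const_mul, ← Real.norm_eq_abs]
  refine norm_integral_le_of_norm_le ((hP.integrable_comp₀ hk _).const_mul M) ?_
  filter_upwards [hP.posLin₀] with b hb
  have h1 := hb.abs_sub_le hf hf' hk h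
  have hnn := hb.nonneg hk hk0
  rw [Real.norm_eq_abs, clampFun_apply, max_eq_right (le_min zero_le_one (by positivity))]
  rcases le_total 1 (η * X₀ b k) with h' | h'
  · rw [min_eq_left h', mul_one, ← Real.norm_eq_abs]
    have := norm_sub_le (g (X₀ b f')) (g (X₀ b f))
    linarith [g.norm_coe_le_norm (X₀ b f'), g.norm_coe_le_norm (X₀ b f)]
  · rw [min_eq_right h']
    exact (hM _ _).trans (by gcongr)

lemma abs_intensity_mul_sub_le (hP : PalmPair m m₀ X X₀ lam) {f h k h₁ : ℝ → ℝ} (hf : IsTest f)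
    (hh : IsTest h) (h0 : ∀ x, 0 ≤ h x) (hint : ∫ x, h x = 1)
    (hh₁ : IsTest h₁) (h₁0 : ∀ x, 0 ≤ h₁ x) (hint₁ : ∫ x, h₁ x = 1)
    (hsupp₁ : ∀ x, 1 ≤ |x| → h₁ x = 0) (hk : IsTest k) (hk₁ : ∀ x, h₁ x ≤ k x)
    {η δ : ℝ} (hη : 0 < η) (hsupp : ∀ x, δ ≤ |x| → h x = 0)
    (hmod : ∀ u, |u| ≤ δ → ∀ v, |v| ≤ 1 → ∀ x, |f (x + u) - f x| ≤ η * k (x + v))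
    {g : BoundedContinuousFunction ℝ ℝ}
    {M : ℝ} (hM : ∀ x y, |g x - g y| ≤ M * |x - y|) (hM' : 2 * ‖g‖ ≤ M) :
    |lam * ∫ b, g (X₀ b f) ∂m₀ - ∫ a, X a h * g (X a f) ∂m| ≤
      M * ∫ a, X a k * clampFun η (X a k) ∂m := by
  have hM0 : 0 ≤ M := (by positivity : 0 ≤ 2 * ‖g‖).trans hM'
  have hk0 : ∀ x, 0 ≤ k x := fun x => (h₁0 x).trans (hk₁ x)
  set I := ∫ a, X a k * clampFun η (X a k) ∂m
  have hI : lam * ∫ v, h₁ v * ∫ b, clampFun η (X₀ b (fun x => k (x + v))) ∂m₀ ≤ I := by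
    rw [← hP.campbell h₁ k hh₁ hk]
    refine integral_mono_ae (hP.integrable_mul hh₁ hk _) (hP.integrable_mul hk hk _) ?_
    filter_upwards [hP.posLin] with a ha
    exact mul_le_mul_of_nonneg_right (ha.mono hh₁ hk hk₁) (clampFun_nonneg _ _)
  have hu : ∀ u, |u| ≤ δ →
      lam * |∫ b, g (X₀ b (fun x => f (x + u))) ∂m₀ - ∫ b, g (X₀ b f) ∂m₀| ≤ M * I := by
    intro u hu
    set c := |∫ b, g (X₀ b (fun x => f (x + u))) ∂m₀ - ∫ b, g (X₀ b f) ∂m₀|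
    have h2 : c ≤ M * ∫ v, h₁ v * ∫ b, clampFun η (X₀ b (fun x => k (x + v))) ∂m₀ := by
      calc c = ∫ v, h₁ v * c := by rw [integral_mul_const, hint₁, one_mul]
        _ ≤ ∫ v, M * (h₁ v * ∫ b, clampFun η (X₀ b (fun x => k (x + v))) ∂m₀) := by
          refine integral_mono (hh₁.integrable.mul_const c)
            ((hP.integrable_translate hh₁ hk _).const_mul M) fun v => ?_
          rcases le_or_gt 1 |v| with hv | hv
          · simp [hsupp₁ v hv]
          · have := hP.abs_comp₀_translate_sub_le hf (hf.translate u) (hk.translate v)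
              (fun x => hk0 _) hM hM' hη (hmod u hu v hv.le)
            calc h₁ v * c ≤ h₁ v * _ := mul_le_mul_of_nonneg_left this (h₁0 v)
              _ = _ := by ring
        _ = _ := integral_const_mul _ _
    calc lam * c ≤ lam * (M * _) := mul_le_mul_of_nonneg_left h2 hP.lam_nonneg
      _ = M * (lam * _) := by ring
      _ ≤ M * I := mul_le_mul_of_nonneg_left hI hM0
  rw [hP.campbell h f hh hf, ← mul_sub]
  have e : ∫ b, g (X₀ b f) ∂m₀ = ∫ u, h u * ∫ b, g (X₀ b f) ∂m₀ := by
    rw [integral_mul_const, hint, one_mul]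
  rw [e, ← integral_sub (hh.integrable.mul_const _) (hP.integrable_translate hh hf g),
    ← integral_const_mul, ← Real.norm_eq_abs]
  have e2 : M * I = ∫ u, h u * (M * I) := by rw [integral_mul_const, hint, one_mul]
  rw [e2]
  refine norm_integral_le_of_norm_le (hh.integrable.mul_const _) (.of_forall fun u => ?_)
  rw [← mul_sub, Real.norm_eq_abs, abs_mul, abs_mul, abs_of_nonneg (h0 u),
    abs_of_nonneg hP.lam_nonneg]
  rcases le_or_gt δ |u| with hv | hv
  · simp [hsupp u hv]
  · have := hu u hv.le
    rw [abs_sub_comm] at this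
    calc _ = h u * (lam * _) := by ring
      _ ≤ _ := mul_le_mul_of_nonneg_left this (h0 u)

end single

section limit

variable {A B A' B' : Type*} [MeasurableSpace A] [MeasurableSpace B] [MeasurableSpace A']
  [MeasurableSpace B'] {m : ℕ → Measure A} {m₀ : ℕ → Measure B} {X : ℕ → A → (ℝ → ℝ) → ℝ}
  {X₀ : ℕ → B → (ℝ → ℝ) → ℝ} {lam : ℕ → ℝ} {m' : Measure A'} {m₀' : Measure B'}
  {X' : A' → (ℝ → ℝ) → ℝ} {X₀' : B' → (ℝ → ℝ) → ℝ} {lam' : ℝ}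

lemma tendsto_integral_mul_of_palm (hP : ∀ n, PalmPair (m n) (m₀ n) (X n) (X₀ n) (lam n))
    (hP' : PalmPair m' m₀' X' X₀' lam') (hlam : Tendsto lam atTop (𝓝 lam'))
    (H : ∀ f, IsTest f → ∀ g : BoundedContinuousFunction ℝ ℝ,
      Tendsto (fun n => ∫ b, g (X₀ n b f) ∂m₀ n) atTop (𝓝 (∫ b, g (X₀' b f) ∂m₀')))
    {h f : ℝ → ℝ} (hh : IsTest h) (hf : IsTest f) (k : BoundedContinuousFunction ℝ ℝ) :
    Tendsto (fun n => ∫ a, X n a h * k (X n a f) ∂m n) atTop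
      (𝓝 (∫ a, X' a h * k (X' a f) ∂m')) := by
  rw [hP'.campbell h f hh hf]
  simp only [(hP _).campbell h f hh hf]
  refine hlam.mul ?_
  refine tendsto_integral_of_dominated_convergence (fun u => |h u| * ‖k‖)
    (fun n => ((hP n).integrable_translate hh hf k).1) (hh.abs.integrable.mul_const _) ?_ ?_
  · refine fun n => .of_forall fun u => ?_
    rw [norm_mul, Real.norm_eq_abs]
    gcongr
    exact (hP n).norm_integral_comp₀_le _ _
  · exact .of_forall fun u => (H _ (hf.translate u) k).const_mul _

theorem tendsto_of_palm (hP : ∀ n, PalmPair (m n) (m₀ n) (X n) (X₀ n) (lam n))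
    (hP' : PalmPair m' m₀' X' X₀' lam') (hlam : Tendsto lam atTop (𝓝 lam'))
    (H : ∀ f, IsTest f → ∀ g : BoundedContinuousFunction ℝ ℝ,
      Tendsto (fun n => ∫ b, g (X₀ n b f) ∂m₀ n) atTop (𝓝 (∫ b, g (X₀' b f) ∂m₀')))
    {f : ℝ → ℝ} (hf : IsTest f) (g : BoundedContinuousFunction ℝ ℝ) :
    Tendsto (fun n => ∫ a, g (X n a f) ∂m n) atTop (𝓝 (∫ a, g (X' a f) ∂m')) := by
  refine tendsto_of_forall_approx fun ε hε => ?_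
  obtain ⟨δ, hδ, hd⟩ := Metric.continuousAt_iff.1 (g.continuous.continuousAt (x := 0)) ε hε
  have hd' : ∀ x, |x| ≤ δ / 2 → |g x - g 0| ≤ ε := fun x hx => by
    have := hd (x := x) (by rw [Real.dist_eq, sub_zero]; linarith)
    exact (Real.dist_eq _ _ ▸ this).le
  have hδ2 : 0 < δ / 2 := by positivity
  refine ⟨_, _, (tendsto_integral_mul_of_palm hP hP' hlam H hf hf
    (regQuot g (δ / 2) hδ2)).const_add (g 0), .of_forall fun n => ?_, ?_⟩
  · exact (hP n).abs_integral_sub_regQuot_le hf hδ2 hε.le hd'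
  · exact hP'.abs_integral_sub_regQuot_le hf hδ2 hε.le hd'

lemma exists_eventually_integral_mul_clampFun_le
    (hP : ∀ n, PalmPair (m n) (m₀ n) (X n) (X₀ n) (lam n))
    (hP' : PalmPair m' m₀' X' X₀' lam') (hlam : Tendsto lam atTop (𝓝 lam'))
    (H : ∀ f, IsTest f → ∀ g : BoundedContinuousFunction ℝ ℝ,
      Tendsto (fun n => ∫ a, g (X n a f) ∂m n) atTop (𝓝 (∫ a, g (X' a f) ∂m')))
    {h : ℝ → ℝ} (hh : IsTest h) (h0 : ∀ x, 0 ≤ h x) {ε M : ℝ} (hε : 0 < ε) (hM : 0 ≤ M) :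
    ∃ η > 0, (∀ᶠ n in atTop, M * ∫ a, X n a h * clampFun η (X n a h) ∂m n ≤ ε) ∧
      M * ∫ a, X' a h * clampFun η (X' a h) ∂m' ≤ ε := by
  obtain ⟨η, hη, h1⟩ := hP'.exists_integral_mul_clampFun_lt hh
    (show 0 < ε / (M + 1) by positivity)
  have aux : ∀ x, x < ε / (M + 1) → M * x ≤ ε := fun x hx => by
    rw [lt_div_iff₀ (by positivity)] at hx
    rcases le_or_gt 0 x with h | h <;> nlinarith
  refine ⟨η, hη, ?_, aux _ h1⟩
  have h2 : Tendsto (fun n => ∫ a, X n a h * clampFun η (X n a h) ∂m n) atTop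
      (𝓝 (∫ a, X' a h * clampFun η (X' a h) ∂m')) := by
    rw [hP'.integral_mul_clampFun hh h0 hη]
    simp only [(hP _).integral_mul_clampFun hh h0 hη]
    exact (hlam.mul_const _).sub (H h hh _)
  filter_upwards [h2.eventually_lt_const h1] with n hn using aux _ hn

lemma tendsto_integral_mul (hP : ∀ n, PalmPair (m n) (m₀ n) (X n) (X₀ n) (lam n))
    (hP' : PalmPair m' m₀' X' X₀' lam') (hlam : Tendsto lam atTop (𝓝 lam'))
    (H : ∀ f, IsTest f → ∀ g : BoundedContinuousFunction ℝ ℝ,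
      Tendsto (fun n => ∫ a, g (X n a f) ∂m n) atTop (𝓝 (∫ a, g (X' a f) ∂m')))
    {h f : ℝ → ℝ} (hh : IsTest h) (h0 : ∀ x, 0 ≤ h x) (hf : IsTest f)
    {g G : BoundedContinuousFunction ℝ ℝ} (hG : ∀ x, HasDerivAt G (g x) x)
    {M : ℝ} (hM : ∀ x y, |g x - g y| ≤ M * |x - y|) (hM' : 2 * ‖g‖ ≤ M) :
    Tendsto (fun n => ∫ a, X n a h * g (X n a f) ∂m n) atTop
      (𝓝 (∫ a, X' a h * g (X' a f) ∂m')) := by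
  have hM0 : 0 ≤ M := (by positivity : 0 ≤ 2 * ‖g‖).trans hM'
  refine tendsto_of_forall_approx fun ε hε => ?_
  obtain ⟨η, hη, h1, h2⟩ :=
    exists_eventually_integral_mul_clampFun_le hP hP' hlam H hh h0 hε hM0
  refine ⟨_, _, ((H _ (hf.add_mul hh η) G).sub (H _ hf G)).div_const η, ?_, ?_⟩
  · filter_upwards [h1] with n hn
    exact ((hP n).abs_integral_mul_sub_slope_le hf hh h0 hG hM hM' hη).trans hn
  · exact (hP'.abs_integral_mul_sub_slope_le hf hh h0 hG hM hM' hη).trans h2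

lemma tendsto_palm_of_hasDerivAt (hP : ∀ n, PalmPair (m n) (m₀ n) (X n) (X₀ n) (lam n))
    (hP' : PalmPair m' m₀' X' X₀' 1) (hlam : Tendsto lam atTop (𝓝 1))
    (H : ∀ f, IsTest f → ∀ g : BoundedContinuousFunction ℝ ℝ,
      Tendsto (fun n => ∫ a, g (X n a f) ∂m n) atTop (𝓝 (∫ a, g (X' a f) ∂m')))
    {f : ℝ → ℝ} (hf : IsTest f)
    {g G : BoundedContinuousFunction ℝ ℝ} (hG : ∀ x, HasDerivAt G (g x) x)
    {M : ℝ} (hM : ∀ x y, |g x - g y| ≤ M * |x - y|) (hM' : 2 * ‖g‖ ≤ M) :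
    Tendsto (fun n => ∫ b, g (X₀ n b f) ∂m₀ n) atTop (𝓝 (∫ b, g (X₀' b f) ∂m₀')) := by
  have hM0 : 0 ≤ M := (by positivity : 0 ≤ 2 * ‖g‖).trans hM'
  have key : Tendsto (fun n => lam n * ∫ b, g (X₀ n b f) ∂m₀ n) atTop
      (𝓝 (1 * ∫ b, g (X₀' b f) ∂m₀')) := by
    refine tendsto_of_forall_approx fun ε hε => ?_
    obtain ⟨h₁, hh₁, h₁0, hint₁, hsupp₁⟩ := exists_bump one_pos
    obtain ⟨k, hk, hk₁, hmod⟩ := hf.exists_modulus hh₁ h₁0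
    obtain ⟨η, hη, h1, h2⟩ := exists_eventually_integral_mul_clampFun_le hP hP' hlam H hk
      (fun x => (h₁0 x).trans (hk₁ x)) hε hM0
    obtain ⟨δ, hδ, hmod⟩ := hmod η hη
    obtain ⟨h, hh, h0, hint, hsupp⟩ := exists_bump hδ
    refine ⟨_, _, tendsto_integral_mul hP hP' hlam H hh h0 hf hG hM hM', ?_, ?_⟩
    · filter_upwards [h1] with n hn
      exact ((hP n).abs_intensity_mul_sub_le hf hh h0 hint hh₁ h₁0 hint₁ hsupp₁ hk hk₁ hη hsupp
        hmod hM hM').trans hn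
    · exact (hP'.abs_intensity_mul_sub_le hf hh h0 hint hh₁ h₁0 hint₁ hsupp₁ hk hk₁ hη hsupp
        hmod hM hM').trans h2
  have h3 := (hlam.inv₀ one_ne_zero).mul key
  rw [one_mul, inv_one, one_mul] at h3
  refine h3.congr' ?_
  filter_upwards [hlam.eventually_ne one_ne_zero] with n hn
  rw [inv_mul_cancel_left₀ hn]

end limit

end PalmPair

/-- The function `x ↦ a * cos (v * x + b)`. -/
noncomputable def cosFun (a v b : ℝ) : BoundedContinuousFunction ℝ ℝ :=
  BoundedContinuousFunction.ofNormedAddCommGroup (fun x => a * Real.cos (v * x + b))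
    (by fun_prop) |a| (fun x => by
      rw [norm_mul, Real.norm_eq_abs, Real.norm_eq_abs]
      exact mul_le_of_le_one_right (abs_nonneg _) (Real.abs_cos_le_one _))

lemma cosFun_apply (a v b x : ℝ) : cosFun a v b x = a * Real.cos (v * x + b) := rfl

lemma hasDerivAt_cosFun {v : ℝ} (hv : v ≠ 0) (b x : ℝ) :
    HasDerivAt (cosFun (1 / v) v (b - Real.pi / 2)) (cosFun 1 v b x) x := by
  have h1 : HasDerivAt (fun y : ℝ => v * y + (b - Real.pi / 2)) (v * 1) x :=
    ((hasDerivAt_id x).const_mul v).add_const _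
  have h2 := (h1.cos).const_mul (1 / v)
  refine h2.congr_deriv ?_
  rw [cosFun_apply, ← add_sub_assoc, Real.sin_sub_pi_div_two]
  field_simp

lemma abs_cosFun_sub_le (v b x y : ℝ) :
    |cosFun 1 v b x - cosFun 1 v b y| ≤ |v| * |x - y| := by
  rw [cosFun_apply, cosFun_apply, one_mul, one_mul, ← abs_mul]
  have := Real.abs_cos_sub_cos_le (v * x + b) (v * y + b)
  have e : v * x + b - (v * y + b) = v * (x - y) := by ring
  rwa [e] at this

/-- Lévy's convergence theorem, phrased for real random variables on varying spaces. -/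
lemma tendsto_integral_of_tendsto_cosFun {B B' : Type*} [MeasurableSpace B] [MeasurableSpace B']
    {μ : ℕ → Measure B} {μ' : Measure B'} [hμ : ∀ n, IsProbabilityMeasure (μ n)]
    [IsProbabilityMeasure μ'] {Y : ℕ → B → ℝ} {Y' : B' → ℝ} (hY : ∀ n, AEMeasurable (Y n) (μ n))
    (hY' : AEMeasurable Y' μ')
    (H : ∀ v b : ℝ, v ≠ 0 → Tendsto (fun n => ∫ ω, cosFun 1 v b (Y n ω) ∂μ n) atTop
      (𝓝 (∫ ω, cosFun 1 v b (Y' ω) ∂μ')))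
    (g : BoundedContinuousFunction ℝ ℝ) :
    Tendsto (fun n => ∫ ω, g (Y n ω) ∂μ n) atTop (𝓝 (∫ ω, g (Y' ω) ∂μ')) := by
  have hp : ∀ n, IsProbabilityMeasure ((μ n).map (Y n)) := fun n =>
    Measure.isProbabilityMeasure_map (hY n)
  have hp' : IsProbabilityMeasure (μ'.map Y') := Measure.isProbabilityMeasure_map hY'
  let ν : ℕ → ProbabilityMeasure ℝ := fun n => ⟨_, hp n⟩
  let ν' : ProbabilityMeasure ℝ := ⟨_, hp'⟩
  have hint : ∀ n (f : BoundedContinuousFunction ℝ ℝ), ∫ x, f x ∂(ν n : Measure ℝ) =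
      ∫ ω, f (Y n ω) ∂μ n := fun n f =>
    integral_map (hY n) f.continuous.aestronglyMeasurable
  have hint' : ∀ (f : BoundedContinuousFunction ℝ ℝ), ∫ x, f x ∂(ν' : Measure ℝ) =
      ∫ ω, f (Y' ω) ∂μ' := fun f => integral_map hY' f.continuous.aestronglyMeasurable
  have hchar : ∀ (ρ : ProbabilityMeasure ℝ) (t : ℝ), charFun (ρ : Measure ℝ) t =
      ((∫ x, cosFun 1 t 0 x ∂(ρ : Measure ℝ) : ℝ) : ℂ) +
        ((∫ x, cosFun 1 t (-(Real.pi / 2)) x ∂(ρ : Measure ℝ) : ℝ) : ℂ) * Complex.I := by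
    intro ρ t
    rw [charFun_apply_real, ← integral_complex_ofReal, ← integral_complex_ofReal,
      ← integral_mul_const, ← integral_add]
    · refine integral_congr_ae (.of_forall fun x => ?_)
      simp only [cosFun_apply, one_mul, add_zero, ← sub_eq_add_neg, Real.cos_sub_pi_div_two]
      rw [← Complex.ofReal_mul, Complex.exp_mul_I, Complex.ofReal_cos, Complex.ofReal_sin]
    · exact ((cosFun 1 t 0).integrable _).ofReal
    · exact (((cosFun 1 t (-(Real.pi / 2))).integrable _).ofReal).mul_const _
  have hconv : Tendsto ν atTop (𝓝 ν') := by
    refine ProbabilityMeasure.tendsto_of_tendsto_charFun fun t => ?_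
    rcases eq_or_ne t 0 with rfl | ht
    · simp
    simp only [hchar, hint, hint']
    exact ((Complex.continuous_ofReal.tendsto _).comp (H t 0 ht)).add
      (((Complex.continuous_ofReal.tendsto _).comp (H t _ ht)).mul_const _)
  have := ProbabilityMeasure.tendsto_iff_forall_integral_tendsto.1 hconv g
  simpa only [hint, hint'] using this

theorem PalmPair.tendsto_palm {A B A' B' : Type*} [MeasurableSpace A] [MeasurableSpace B]
    [MeasurableSpace A'] [MeasurableSpace B'] {m : ℕ → Measure A} {m₀ : ℕ → Measure B}
    {X : ℕ → A → (ℝ → ℝ) → ℝ} {X₀ : ℕ → B → (ℝ → ℝ) → ℝ} {lam : ℕ → ℝ} {m' : Measure A'}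
    {m₀' : Measure B'} {X' : A' → (ℝ → ℝ) → ℝ} {X₀' : B' → (ℝ → ℝ) → ℝ}
    (hP : ∀ n, PalmPair (m n) (m₀ n) (X n) (X₀ n) (lam n))
    (hP' : PalmPair m' m₀' X' X₀' 1) (hlam : Tendsto lam atTop (𝓝 1))
    (H : ∀ f, IsTest f → ∀ g : BoundedContinuousFunction ℝ ℝ,
      Tendsto (fun n => ∫ a, g (X n a f) ∂m n) atTop (𝓝 (∫ a, g (X' a f) ∂m')))
    {f : ℝ → ℝ} (hf : IsTest f) (g : BoundedContinuousFunction ℝ ℝ) :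
    Tendsto (fun n => ∫ b, g (X₀ n b f) ∂m₀ n) atTop (𝓝 (∫ b, g (X₀' b f) ∂m₀')) := by
  have := fun n => (hP n).prob₀
  have := hP'.prob₀
  refine tendsto_integral_of_tendsto_cosFun (fun n => ((hP n).aesm₀ f hf).aemeasurable)
    (hP'.aesm₀ f hf).aemeasurable (fun v b hv => ?_) g
  exact PalmPair.tendsto_palm_of_hasDerivAt hP hP' hlam H hf (hasDerivAt_cosFun hv b)
    (M := max |v| (2 * ‖cosFun 1 v b‖))
    (fun x y => (abs_cosFun_sub_le v b x y).trans (by gcongr; exact le_max_left _ _))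
    (le_max_right _ _)

open ProbabilityTheory

/-- The locally finite measures on the line. -/
def locFin : Set (Measure ℝ) := {ν | ∀ n : ℕ, ν (Set.Icc (-n : ℝ) n) < ⊤}

lemma measurableSet_locFin : MeasurableSet locFin := by
  have : locFin = ⋂ n : ℕ, {ν : Measure ℝ | ν (Set.Icc (-n : ℝ) n) < ⊤} := by
    ext ν
    simp [locFin]
  rw [this]
  exact MeasurableSet.iInter fun n =>
    measurableSet_lt (Measure.measurable_coe measurableSet_Icc) measurable_const

lemma lt_top_of_mem_locFin {ν : Measure ℝ} (h : ν ∈ locFin) {s : Set ℝ} (hs : IsBounded s) :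
    ν s < ⊤ := by
  obtain ⟨R, hR⟩ := hs.exists_norm_le
  obtain ⟨n, hn⟩ := exists_nat_ge R
  refine (measure_mono fun x hx => ?_).trans_lt (h n)
  rw [Set.mem_Icc, ← abs_le]
  exact (hR x hx).trans hn

lemma isFiniteMeasureOnCompacts_of_mem_locFin {ν : Measure ℝ} (h : ν ∈ locFin) :
    IsFiniteMeasureOnCompacts ν :=
  ⟨fun _ hK => lt_top_of_mem_locFin h hK.isBounded⟩

lemma IsPointMeasure.mem_locFin {ν : Measure ℝ} (h : IsPointMeasure ν) : ν ∈ locFin := fun n => by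
  obtain ⟨m, hm⟩ := h _ measurableSet_Icc (Metric.isBounded_Icc (-n : ℝ) n)
  rw [hm]
  exact ENNReal.natCast_lt_top m

lemma translateMeasure_apply (s : ℝ) (ν : Measure ℝ) {A : Set ℝ} (hA : MeasurableSet A) :
    translateMeasure s ν A = ν ((fun x => x - s) ⁻¹' A) :=
  Measure.map_apply (measurable_sub_const s) hA

lemma translateMeasure_add (s u : ℝ) (ν : Measure ℝ) :
    translateMeasure s (translateMeasure u ν) = translateMeasure (u + s) ν := by
  rw [translateMeasure, translateMeasure, translateMeasure,
    Measure.map_map (measurable_sub_const s) (measurable_sub_const u)]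
  congr 1
  ext x
  simp only [Function.comp]
  ring

lemma translateMeasure_mem_locFin {s : ℝ} {ν : Measure ℝ} (h : ν ∈ locFin) :
    translateMeasure s ν ∈ locFin := fun n => by
  rw [translateMeasure_apply s ν measurableSet_Icc, Set.preimage_sub_const_Icc]
  exact lt_top_of_mem_locFin h (Metric.isBounded_Icc _ _)

lemma translateMeasure_mem_locFin_iff {s : ℝ} {ν : Measure ℝ} :
    translateMeasure s ν ∈ locFin ↔ ν ∈ locFin := by
  refine ⟨fun h => ?_, translateMeasure_mem_locFin⟩
  have := translateMeasure_mem_locFin (s := -s) h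
  rwa [translateMeasure_add, add_neg_cancel, translateMeasure,
    show (fun x : ℝ => x - 0) = id from funext sub_zero, Measure.map_id] at this

/-- The identity kernel on locally finite measures, extended by zero. -/
noncomputable def locFinKernel : Kernel (Measure ℝ) ℝ where
  toFun := locFin.indicator id
  measurable' := measurable_id.indicator measurableSet_locFin

lemma locFinKernel_of_mem {ν : Measure ℝ} (h : ν ∈ locFin) : locFinKernel ν = ν :=
  Set.indicator_of_mem h id

lemma locFinKernel_of_notMem {ν : Measure ℝ} (h : ν ∉ locFin) : locFinKernel ν = 0 :=
  Set.indicator_of_notMem h id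

lemma locFinKernel_mem (ν : Measure ℝ) : locFinKernel ν ∈ locFin := by
  by_cases h : ν ∈ locFin
  · rwa [locFinKernel_of_mem h]
  · rw [locFinKernel_of_notMem h]
    intro n
    simp

lemma locFinKernel_translate (s : ℝ) (ν : Measure ℝ) :
    locFinKernel (translateMeasure s ν) = translateMeasure s (locFinKernel ν) := by
  by_cases h : ν ∈ locFin
  · rw [locFinKernel_of_mem h, locFinKernel_of_mem (translateMeasure_mem_locFin h)]
  · rw [locFinKernel_of_notMem h, locFinKernel_of_notMem (mt translateMeasure_mem_locFin_iff.1 h),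
      translateMeasure, Measure.map_zero]

/-- The part of `locFinKernel` on a unit interval, for the measures of roughly given mass there. -/
noncomputable def locFinKernelPiece (p : ℤ × ℕ) : Kernel (Measure ℝ) ℝ where
  toFun := fun ν => ({ν : Measure ℝ | ⌊(locFinKernel ν (Set.Ioc (p.1 : ℝ) (p.1 + 1))).toReal⌋₊ = p.2}).indicator
      (fun ν => (locFinKernel ν).restrict (Set.Ioc (p.1 : ℝ) (p.1 + 1))) ν
  measurable' := by
    refine Measurable.indicator ?_ ?_
    · exact (Kernel.restrict locFinKernel measurableSet_Ioc).measurable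
    · exact (Nat.measurable_floor.comp
        (Kernel.measurable_coe locFinKernel measurableSet_Ioc).ennreal_toReal)
        (measurableSet_singleton p.2)

instance (p : ℤ × ℕ) : IsFiniteKernel (locFinKernelPiece p) := by
  refine ⟨⟨(p.2 + 1 : ℕ), ENNReal.natCast_lt_top _, fun ν => ?_⟩⟩
  change (Set.indicator _ _ ν : Measure ℝ) _ ≤ _
  by_cases h : ⌊(locFinKernel ν (Set.Ioc (p.1 : ℝ) (p.1 + 1))).toReal⌋₊ = p.2
  · rw [Set.indicator_of_mem (by exact h), Measure.restrict_apply MeasurableSet.univ, Set.univ_inter]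
    have h1 := (lt_top_of_mem_locFin (locFinKernel_mem ν)
      (Metric.isBounded_Ioc (p.1 : ℝ) (p.1 + 1))).ne
    rw [← ENNReal.ofReal_toReal h1, ← ENNReal.ofReal_natCast]
    apply ENNReal.ofReal_le_ofReal
    rw [← h]
    push_cast
    exact (Nat.lt_floor_add_one _).le
  · rw [Set.indicator_of_notMem (by exact h)]
    simp

lemma locFinKernel_eq_sum : locFinKernel = Kernel.sum locFinKernelPiece := by
  ext ν s hs
  rw [Kernel.sum_apply' _ _ hs, ENNReal.summable.tsum_prod' (fun _ => ENNReal.summable)]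
  have : ∀ n : ℤ, ∑' k : ℕ, locFinKernelPiece (n, k) ν s =
      (locFinKernel ν).restrict (Set.Ioc (n : ℝ) (n + 1)) s := fun n => by
    rw [tsum_eq_single ⌊(locFinKernel ν (Set.Ioc (n : ℝ) (n + 1))).toReal⌋₊]
    · change (Set.indicator _ _ ν : Measure ℝ) s = _
      rw [Set.indicator_of_mem (by exact rfl)]
    · intro k hk
      change (Set.indicator _ _ ν : Measure ℝ) s = _
      rw [Set.indicator_of_notMem (by exact hk.symm)]
      rfl
  rw [tsum_congr this, ← Measure.sum_apply _ hs,
    ← Measure.restrict_iUnion (Set.pairwise_disjoint_Ioc_intCast ℝ) fun _ => measurableSet_Ioc,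
    iUnion_Ioc_intCast, Measure.restrict_univ]

instance : IsSFiniteKernel locFinKernel := by
  rw [locFinKernel_eq_sum]
  infer_instance

lemma measurable_translateMeasure_locFinKernel :
    Measurable (fun p : Measure ℝ × ℝ => translateMeasure p.2 (locFinKernel p.1)) := by
  refine Measure.measurable_of_measurable_coe _ fun A hA => ?_
  have h1 : MeasurableSet {q : (Measure ℝ × ℝ) × ℝ | q.2 - q.1.2 ∈ A} :=
    (measurable_snd.sub (measurable_snd.comp measurable_fst)) hA
  have h2 := Kernel.measurable_kernel_prodMk_left (κ := Kernel.prodMkRight ℝ locFinKernel) h1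
  convert h2 using 2 with p
  rw [translateMeasure_apply _ _ hA, Kernel.prodMkRight_apply]
  rfl

lemma measurable_translateMeasure (s : ℝ) : Measurable (translateMeasure s) :=
  Measure.measurable_map _ (measurable_sub_const s)

lemma measurableSet_translateMeasure_mem {E : Set (Measure ℝ)} (hE : MeasurableSet E) :
    MeasurableSet {p : Measure ℝ × ℝ | translateMeasure p.2 (locFinKernel p.1) ∈ E} :=
  measurable_translateMeasure_locFinKernel hE

lemma measurableSet_setOf_translateMeasure_mem {E : Set (Measure ℝ)} (hE : MeasurableSet E)
    {B : Set ℝ} (hB : MeasurableSet B) (ν : Measure ℝ) :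
    MeasurableSet {s | s ∈ B ∧ translateMeasure s (locFinKernel ν) ∈ E} :=
  hB.inter (measurable_prodMk_left (measurableSet_translateMeasure_mem hE))

/-- The distribution of a uniformly chosen point together with the measure seen from it. -/
noncomputable def campbellMeasure (Q : Measure (Measure ℝ)) : Measure (ℝ × Measure ℝ) :=
  (Q ⊗ₘ locFinKernel).map (fun p => (p.2, translateMeasure p.2 (locFinKernel p.1)))

lemma measurable_snd_prodMk_translateMeasure :
    Measurable (fun p : Measure ℝ × ℝ => (p.2, translateMeasure p.2 (locFinKernel p.1))) :=
  measurable_snd.prodMk measurable_translateMeasure_locFinKernel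

lemma campbellMeasure_prod (Q : Measure (Measure ℝ)) [IsProbabilityMeasure Q]
    {E : Set (Measure ℝ)} (hE : MeasurableSet E) {B : Set ℝ} (hB : MeasurableSet B) :
    campbellMeasure Q (B ×ˢ E) =
      ∫⁻ ν, locFinKernel ν {s | s ∈ B ∧ translateMeasure s (locFinKernel ν) ∈ E} ∂Q := by
  rw [campbellMeasure, Measure.map_apply measurable_snd_prodMk_translateMeasure (hB.prod hE),
    Measure.compProd_apply (measurable_snd_prodMk_translateMeasure (hB.prod hE))]
  rfl

lemma campbellMeasure_prod_preimage_sub (Q : Measure (Measure ℝ)) [IsProbabilityMeasure Q]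
    (hstat : ∀ s, Q.map (translateMeasure s) = Q)
    {E : Set (Measure ℝ)} (hE : MeasurableSet E) {B : Set ℝ} (hB : MeasurableSet B) (u : ℝ) :
    campbellMeasure Q (((fun x => x - u) ⁻¹' B) ×ˢ E) = campbellMeasure Q (B ×ˢ E) := by
  rw [campbellMeasure_prod Q hE hB, campbellMeasure_prod Q hE (measurable_sub_const u hB)]
  nth_rw 2 [← hstat u]
  rw [lintegral_map _ (measurable_translateMeasure u)]
  · refine lintegral_congr fun ν => ?_
    simp only [locFinKernel_translate, translateMeasure_add]
    rw [translateMeasure_apply]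
    · simp [Set.preimage]
    · have := measurableSet_setOf_translateMeasure_mem hE hB (translateMeasure u ν)
      simpa only [locFinKernel_translate, translateMeasure_add] using this
  · exact Kernel.measurable_kernel_prodMk_left (κ := locFinKernel)
      (t := {p : Measure ℝ × ℝ | p.2 ∈ B ∧ translateMeasure p.2 (locFinKernel p.1) ∈ E})
      ((measurable_snd hB).inter (measurableSet_translateMeasure_mem hE))

lemma campbellMeasure_eq_prod (Q Q₀ : Measure (Measure ℝ)) [IsProbabilityMeasure Q]
    [IsProbabilityMeasure Q₀] (hstat : ∀ s, Q.map (translateMeasure s) = Q)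
    (hint : ∀ B, MeasurableSet B → ∫⁻ ν, locFinKernel ν B ∂Q = volume B)
    (hpalm : ∀ E, MeasurableSet E → Q₀ E = ∫⁻ ν, locFinKernel ν
      {s | s ∈ Set.Ioc (0 : ℝ) 1 ∧ translateMeasure s (locFinKernel ν) ∈ E} ∂Q) :
    campbellMeasure Q = (volume : Measure ℝ).prod Q₀ := by
  symm
  refine Measure.prod_eq fun B E hB hE => ?_
  set ρ : Measure ℝ := ((campbellMeasure Q).restrict (Set.univ ×ˢ E)).map Prod.fst with hρdef
  have hρ : ∀ A, MeasurableSet A → ρ A = campbellMeasure Q (A ×ˢ E) := fun A hA => by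
    rw [hρdef, Measure.map_apply measurable_fst hA, Measure.restrict_apply (measurable_fst hA)]
    congr 1
    ext p
    simp
  have hle : ρ ≤ volume := by
    refine Measure.le_iff.2 fun A hA => ?_
    rw [hρ A hA, campbellMeasure_prod Q hE hA, ← hint A hA]
    exact lintegral_mono fun ν => measure_mono fun s hs => hs.1
  have : IsFiniteMeasureOnCompacts ρ := ⟨fun K hK => (hle K).trans_lt hK.measure_lt_top⟩
  have : ρ.IsAddLeftInvariant := by
    rw [← forall_measure_preimage_add_iff]
    intro u A hA
    have := campbellMeasure_prod_preimage_sub Q hstat hE hA (-u)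
    rw [hρ _ hA, ← this, hρ _ (measurable_const_add u hA)]
    simp only [sub_neg_eq_add, add_comm]
  obtain ⟨k, h1⟩ : ∃ k : NNReal, ρ = k • volume := ⟨_, Measure.isAddLeftInvariant_eq_smul ρ volume⟩
  have h2 : Q₀ E = k := by
    rw [hpalm E hE, ← campbellMeasure_prod Q hE measurableSet_Ioc, ← hρ _ measurableSet_Ioc, h1]
    simp
  rw [← hρ B hB, h2, h1, mul_comm]
  rfl

lemma locFinKernel_locFinKernel (ν : Measure ℝ) : locFinKernel (locFinKernel ν) = locFinKernel ν :=
  locFinKernel_of_mem (locFinKernel_mem ν)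

instance (ν : Measure ℝ) : IsFiniteMeasureOnCompacts (locFinKernel ν) :=
  isFiniteMeasureOnCompacts_of_mem_locFin (locFinKernel_mem ν)

lemma IsTest.integrable_locFinKernel {f : ℝ → ℝ} (hf : IsTest f) (ν : Measure ℝ) :
    Integrable f (locFinKernel ν) :=
  hf.cont.integrable_of_hasCompactSupport hf.supp

lemma isPosLin_integral_locFinKernel (ν : Measure ℝ) :
    IsPosLin (fun f => ∫ x, f x ∂(locFinKernel ν)) := by
  intro f f' k hf hf' hk b hle
  rw [← integral_const_mul, ← integral_add (hf.integrable_locFinKernel ν)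
    ((hk.integrable_locFinKernel ν).const_mul b)]
  exact integral_mono (hf'.integrable_locFinKernel ν)
    ((hf.integrable_locFinKernel ν).add ((hk.integrable_locFinKernel ν).const_mul b)) hle

lemma integral_translate_locFinKernel {f : ℝ → ℝ} (hf : IsTest f) (s : ℝ) (ν : Measure ℝ) :
    ∫ x, f (x + s) ∂(locFinKernel (translateMeasure s (locFinKernel ν))) =
      ∫ x, f x ∂(locFinKernel ν) := by
  rw [locFinKernel_translate, locFinKernel_locFinKernel, translateMeasure,
    integral_map (measurable_sub_const s).aemeasurable
      (hf.translate s).cont.aestronglyMeasurable]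
  simp

lemma stronglyMeasurable_integral_locFinKernel {f : ℝ → ℝ} (hf : IsTest f) :
    StronglyMeasurable (fun ν : Measure ℝ => ∫ x, f x ∂(locFinKernel ν)) :=
  StronglyMeasurable.integral_kernel_prod_right' (κ := locFinKernel)
    (hf.cont.comp_stronglyMeasurable measurable_snd.stronglyMeasurable)

lemma stronglyMeasurable_integral_locFinKernel_translate {f : ℝ → ℝ} (hf : IsTest f) :
    StronglyMeasurable (fun p : ℝ × Measure ℝ => ∫ x, f (x + p.1) ∂(locFinKernel p.2)) :=
  StronglyMeasurable.integral_kernel_prod_right' (κ := Kernel.prodMkLeft ℝ locFinKernel)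
    (f := fun q : (ℝ × Measure ℝ) × ℝ => f (q.2 + q.1.1))
    (hf.cont.comp_stronglyMeasurable
      (measurable_snd.add (measurable_fst.comp measurable_fst)).stronglyMeasurable)

theorem palmPair_locFinKernel (Q Q₀ : Measure (Measure ℝ)) [IsProbabilityMeasure Q]
    [IsProbabilityMeasure Q₀] (hstat : ∀ s, Q.map (translateMeasure s) = Q)
    (hint : ∀ B, MeasurableSet B → ∫⁻ ν, locFinKernel ν B ∂Q = volume B)
    (hpalm : ∀ E, MeasurableSet E → Q₀ E = ∫⁻ ν, locFinKernel ν
      {s | s ∈ Set.Ioc (0 : ℝ) 1 ∧ translateMeasure s (locFinKernel ν) ∈ E} ∂Q) :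
    PalmPair Q Q₀ (fun ν f => ∫ x, f x ∂(locFinKernel ν))
      (fun ν f => ∫ x, f x ∂(locFinKernel ν)) 1 where
  prob := inferInstance
  prob₀ := inferInstance
  lam_nonneg := zero_le_one
  integrable f hf := by
    refine ⟨(stronglyMeasurable_integral_locFinKernel hf).aestronglyMeasurable, ?_⟩
    have hb : Q.bind locFinKernel = volume := by
      ext B hB
      rw [Measure.bind_apply hB locFinKernel.measurable.aemeasurable, hint B hB]
    calc ∫⁻ ν, ‖∫ x, f x ∂(locFinKernel ν)‖ₑ ∂Q
        ≤ ∫⁻ ν, ∫⁻ x, ‖f x‖ₑ ∂(locFinKernel ν) ∂Q :=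
          lintegral_mono fun ν => enorm_integral_le_lintegral_enorm _
      _ = ∫⁻ x, ‖f x‖ₑ ∂(Q.bind locFinKernel) :=
          (Measure.lintegral_bind locFinKernel.measurable.aemeasurable
            hf.cont.enorm.measurable.aemeasurable).symm
      _ < ⊤ := by
          rw [hb]
          exact hf.integrable.2
  aesm₀ f hf := (stronglyMeasurable_integral_locFinKernel hf).aestronglyMeasurable
  posLin := ae_of_all _ isPosLin_integral_locFinKernel
  posLin₀ := ae_of_all _ isPosLin_integral_locFinKernel
  campbell h f hh hf k := by
    set G : ℝ × Measure ℝ → ℝ := fun p => h p.1 * k (∫ x, f (x + p.1) ∂(locFinKernel p.2)) with hG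
    have hGm : StronglyMeasurable G :=
      (hh.cont.comp_stronglyMeasurable measurable_fst.stronglyMeasurable).mul
        (k.continuous.comp_stronglyMeasurable (stronglyMeasurable_integral_locFinKernel_translate hf))
    have hGi : Integrable G ((volume : Measure ℝ).prod Q₀) :=
      (hh.integrable.comp_fst Q₀).mul_bdd (c := ‖k‖)
        (k.continuous.comp_stronglyMeasurable
          (stronglyMeasurable_integral_locFinKernel_translate hf)).aestronglyMeasurable
        (ae_of_all _ fun p => k.norm_coe_le_norm _)
    have e1 : ∫ p, G p ∂((volume : Measure ℝ).prod Q₀) =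
        ∫ u, h u * ∫ ν, k (∫ x, f (x + u) ∂(locFinKernel ν)) ∂Q₀ := by
      rw [integral_prod _ hGi]
      simp only [hG, integral_const_mul]
    rw [one_mul, ← e1, ← campbellMeasure_eq_prod Q Q₀ hstat hint hpalm, campbellMeasure,
      integral_map measurable_snd_prodMk_translateMeasure.aemeasurable hGm.aestronglyMeasurable,
      Measure.integral_compProd]
    · simp only [hG, integral_translate_locFinKernel hf, integral_mul_const]
    · rw [← campbellMeasure_eq_prod Q Q₀ hstat hint hpalm, campbellMeasure] at hGi
      exact hGi.comp_measurable measurable_snd_prodMk_translateMeasure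

theorem palmPair_of_isPalmOf {Ω Ω' : Type*} [MeasurableSpace Ω] [MeasurableSpace Ω']
    (P : Measure Ω) (P' : Measure Ω') [IsProbabilityMeasure P] [IsProbabilityMeasure P']
    (ξ : Ω → Measure ℝ) (ξ0 : Ω' → Measure ℝ) (hξ : Measurable ξ) (hξ0 : Measurable ξ0)
    (hpp : ∀ᵐ ω ∂P, IsPointMeasure (ξ ω)) (hstat : Stationary P ξ) (hint : HasIntensity P ξ 1)
    (hpalm : IsPalmOf P ξ P' ξ0 1) :
    PalmPair (P.map ξ) (P'.map ξ0) (fun ν f => ∫ x, f x ∂(locFinKernel ν))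
      (fun ν f => ∫ x, f x ∂(locFinKernel ν)) 1 := by
  have := Measure.isProbabilityMeasure_map (μ := P) hξ.aemeasurable
  have := Measure.isProbabilityMeasure_map (μ := P') hξ0.aemeasurable
  refine palmPair_locFinKernel _ _ (fun s => ?_) (fun B hB => ?_) (fun E hE => ?_)
  · rw [Measure.map_map (measurable_translateMeasure s) hξ]
    exact hstat s
  · rw [lintegral_map (Kernel.measurable_coe _ hB) hξ, ← one_mul (volume B), ← hint B hB]
    refine lintegral_congr_ae ?_
    filter_upwards [hpp] with ω hω
    rw [locFinKernel_of_mem hω.mem_locFin]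
  · rw [Measure.map_apply hξ0 hE]
    refine (hpalm E hE).trans ?_
    rw [inv_one, one_mul, lintegral_map _ hξ]
    · refine lintegral_congr_ae ?_
      filter_upwards [hpp] with ω hω
      have hm := measurableSet_setOf_translateMeasure_mem hE MeasurableSet.univ (ξ ω)
      simp only [locFinKernel_of_mem hω.mem_locFin, Set.mem_univ, true_and] at hm ⊢
      have e : ∀ s, E.indicator (fun _ => (1 : ENNReal)) (translateMeasure s (ξ ω)) =
          {s | translateMeasure s (ξ ω) ∈ E}.indicator 1 s := fun s => rfl
      simp only [e]
      rw [lintegral_indicator_one hm, Measure.restrict_apply hm, Set.inter_comm]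
      rfl
    · exact Kernel.measurable_kernel_prodMk_left (κ := locFinKernel)
        (t := {p : Measure ℝ × ℝ | p.2 ∈ Set.Ioc (0 : ℝ) 1 ∧
          translateMeasure p.2 (locFinKernel p.1) ∈ E})
        ((measurable_snd measurableSet_Ioc).inter (measurableSet_translateMeasure_mem hE))

lemma integral_map_locFinKernel {Ω : Type*} [MeasurableSpace Ω] {P : Measure Ω} {ξ : Ω → Measure ℝ}
    (hξ : Measurable ξ) (hpp : ∀ᵐ ω ∂P, IsPointMeasure (ξ ω)) {f : ℝ → ℝ} (hf : IsTest f)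
    (g : BoundedContinuousFunction ℝ ℝ) :
    ∫ ν, g (∫ x, f x ∂(locFinKernel ν)) ∂(P.map ξ) = ∫ ω, g (∫ x, f x ∂(ξ ω)) ∂P := by
  rw [integral_map hξ.aemeasurable (g.continuous.comp_stronglyMeasurable
    (stronglyMeasurable_integral_locFinKernel hf)).aestronglyMeasurable]
  refine integral_congr_ae ?_
  filter_upwards [hpp] with ω hω
  rw [locFinKernel_of_mem hω.mem_locFin]

/-- A bi-infinite sequence of points invariant under translation by `T`, with `N` points per
period. -/
structure IsPeriodicSeq (d : ℤ → ℝ) (N : ℕ) (T : ℝ) : Prop where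
  card_pos : 0 < N
  period_pos : 0 < T
  add_card : ∀ n, d (n + N) = d n + T

namespace IsPeriodicSeq

variable {d : ℤ → ℝ} {N : ℕ} {T : ℝ} {f : ℝ → ℝ}

lemma periodic_sub (hd : IsPeriodicSeq d N T) :
    Function.Periodic (fun n : ℤ => d n - n * (T / N)) (N : ℤ) := fun n => by
  have : (N : ℝ) ≠ 0 := by exact_mod_cast hd.card_pos.ne'
  simp only [hd.add_card]
  push_cast
  field_simp
  ring

lemma add_mul_card (hd : IsPeriodicSeq d N T) (n j : ℤ) : d (n + j * N) = d n + j * T := by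
  have : (N : ℝ) ≠ 0 := by exact_mod_cast hd.card_pos.ne'
  have h := (hd.periodic_sub.int_mul j) n
  simp only [Int.cast_id] at h
  push_cast at h
  have e : ((n : ℝ) + j * N) * (T / N) = n * (T / N) + j * T := by field_simp
  rw [e] at h
  linarith

lemma finite_setOf_abs_lt (hd : IsPeriodicSeq d N T) (M : ℝ) : {n | |d n| < M}.Finite := by
  have hN : (0 : ℝ) < N := by exact_mod_cast hd.card_pos
  have hT := hd.period_pos
  have hfin : (Set.range (fun n : ℤ => d n - n * (T / N))).Finite := by
    refine ((Set.finite_Ico (0 : ℤ) N).image (fun n : ℤ => d n - n * (T / N))).subset ?_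
    rintro _ ⟨n, rfl⟩
    obtain ⟨m, hm, he⟩ := hd.periodic_sub.exists_mem_Ico₀ (by exact_mod_cast hd.card_pos) n
    exact ⟨m, hm, he.symm⟩
  obtain ⟨D, hD⟩ := hfin.isBounded.exists_norm_le
  refine (Set.finite_Icc (-⌈(M + D) / (T / N)⌉) ⌈(M + D) / (T / N)⌉).subset fun n hn => ?_
  have h1 : |d n - n * (T / N)| ≤ D := hD _ ⟨n, rfl⟩
  have h2 : |d n| < M := hn
  have h3 : |(n : ℝ)| * (T / N) ≤ M + D := by
    have := abs_sub_abs_le_abs_sub ((n : ℝ) * (T / N)) (d n)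
    rw [abs_sub_comm, abs_mul, abs_of_pos (div_pos hT hN)] at this
    linarith
  rw [← le_div_iff₀ (div_pos hT hN)] at h3
  rw [Set.mem_Icc, ← abs_le]
  exact_mod_cast h3.trans (Int.le_ceil _)

lemma exists_finset (hd : IsPeriodicSeq d N T) (hf : IsTest f) (K : ℝ) :
    ∃ s : Finset ℤ, ∀ t, |t| ≤ K → ∀ n ∉ s, f (d n - t) = 0 := by
  obtain ⟨R, -, hR⟩ := hf.exists_radius
  refine ⟨(hd.finite_setOf_abs_lt (R + K)).toFinset, fun t ht n hn => hR _ ?_⟩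
  rw [Set.Finite.mem_toFinset, Set.mem_ofPred_eq, not_lt] at hn
  have := abs_sub_abs_le_abs_sub (d n) t
  linarith

lemma summable (hd : IsPeriodicSeq d N T) (hf : IsTest f) (t : ℝ) :
    Summable (fun n => f (d n - t)) := by
  obtain ⟨s, hs⟩ := hd.exists_finset hf |t|
  exact summable_of_ne_finset_zero (hs t le_rfl)

lemma isPosLin (hd : IsPeriodicSeq d N T) (t : ℝ) :
    IsPosLin (fun f => ∑' n, f (d n - t)) := by
  intro f f' k hf hf' hk b hle
  rw [← tsum_mul_left, ← (hd.summable hf t).tsum_add ((hd.summable hk t).mul_left b)]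
  exact (hd.summable hf' t).tsum_le_tsum (fun n => hle _)
    ((hd.summable hf t).add ((hd.summable hk t).mul_left b))

lemma continuous_tsum (hd : IsPeriodicSeq d N T) (hf : IsTest f) :
    Continuous (fun t => ∑' n, f (d n - t)) := by
  rw [continuous_iff_continuousAt]
  intro t₀
  obtain ⟨s, hs⟩ := hd.exists_finset hf (|t₀| + 1)
  have h : (fun t => ∑ n ∈ s, f (d n - t)) =ᶠ[𝓝 t₀] fun t => ∑' n, f (d n - t) := by
    have : ∀ᶠ t in 𝓝 t₀, |t| < |t₀| + 1 :=
      continuous_abs.continuousAt.eventually_lt continuousAt_const (by simp)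
    filter_upwards [this] with t ht
    exact (tsum_eq_sum (hs t ht.le)).symm
  refine ContinuousAt.congr ?_ h
  have := hf.cont
  fun_prop

lemma periodic_tsum (hd : IsPeriodicSeq d N T) (f : ℝ → ℝ) :
    Function.Periodic (fun t => ∑' n, f (d n - t)) T := fun t => by
  simp only
  rw [← (Equiv.addRight (N : ℤ)).tsum_eq]
  refine tsum_congr fun n => ?_
  simp only [Equiv.coe_addRight, hd.add_card]
  congr 1
  ring

/-- Unfolding over the translates of a single point. -/
lemma tsum_integral_translates {F r : ℝ → ℝ} (hT : 0 < T) (hr : Function.Periodic r T) (x : ℝ)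
    (hF : Integrable (fun t => F (x - t) * r t)) :
    ∑' j : ℤ, ∫ t in (0 : ℝ)..T, F (x + j * T - t) * r t = ∫ u, F u * r (x - u) := by
  have h1 : ∀ j : ℤ, ∫ t in (0 : ℝ)..T, F (x + j * T - t) * r t =
      ∫ t in Set.Ioc (0 + (-j) • T) (0 + (-j + 1) • T), F (x - t) * r t := fun j => by
    rw [← intervalIntegral.integral_of_le (by gcongr; simp),
      show (0 : ℝ) + (-j + 1) • T = T + (-j) • T by simp [add_mul, add_comm],
      ← intervalIntegral.integral_comp_add_right]
    refine intervalIntegral.integral_congr fun t _ => ?_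
    congr 1
    · congr 1
      simp
      ring
    · exact ((hr.zsmul (-j)) t).symm
  rw [tsum_congr h1]
  refine ((Equiv.neg ℤ).tsum_eq
    (fun j : ℤ => ∫ t in Set.Ioc (0 + j • T) (0 + (j + 1) • T), F (x - t) * r t)).trans ?_
  rw [← integral_iUnion (fun _ => measurableSet_Ioc) (Set.pairwise_disjoint_Ioc_add_zsmul 0 T),
    iUnion_Ioc_add_zsmul hT, setIntegral_univ,
    ← integral_sub_left_eq_self _ _ x]
  · simp
  · exact hF.integrableOn

lemma integral_tsum_mul (hd : IsPeriodicSeq d N T) {h r : ℝ → ℝ} (hh : IsTest h)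
    (hrc : Continuous r) (hr : Function.Periodic r T) :
    ∫ t in (0 : ℝ)..T, (∑' n, h (d n - t)) * r t =
      ∑ m ∈ Finset.Icc 1 N, ∫ u, h u * r (d (m : ℤ) - u) := by
  have : NeZero N := ⟨hd.card_pos.ne'⟩
  have hT := hd.period_pos
  obtain ⟨s, hs⟩ := hd.exists_finset hh T
  have hs' : ∀ t ∈ Set.uIcc 0 T, ∀ n ∉ s, h (d n - t) = 0 := fun t ht n hn => by
    rw [Set.uIcc_of_le hT.le] at ht
    exact hs t (by rw [abs_of_nonneg ht.1]; exact ht.2) n hn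
  set a : ℤ → ℝ := fun n => ∫ t in (0 : ℝ)..T, h (d n - t) * r t with ha
  have ha0 : ∀ n ∉ s, a n = 0 := fun n hn => by
    rw [ha]
    refine (intervalIntegral.integral_congr (g := fun _ => 0) fun t ht => ?_).trans (by simp)
    simp [hs' t ht n hn]
  have hc := hh.cont
  have e1 : ∫ t in (0 : ℝ)..T, (∑' n, h (d n - t)) * r t = ∑' n, a n := by
    rw [tsum_eq_sum ha0, ha, ← intervalIntegral.integral_finsetSum]
    · refine intervalIntegral.integral_congr fun t ht => ?_
      rw [tsum_eq_sum (hs' t ht), Finset.sum_mul]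
    · intro n _
      exact Continuous.intervalIntegrable (by fun_prop) _ _
  have hsum : Summable a := summable_of_ne_finset_zero ha0
  let e : Fin N × ℤ ≃ ℤ :=
    (Equiv.prodComm _ _).trans ((Int.divModEquiv N).symm.trans (Equiv.addRight 1))
  have he : ∀ p, e p = ((p.1 + 1 : ℕ) : ℤ) + p.2 * N := fun p => by
    simp only [e, Int.divModEquiv, Equiv.trans_apply, Equiv.prodComm_apply, Equiv.coe_fn_symm_mk,
      Equiv.coe_addRight, Prod.fst_swap, Prod.snd_swap]
    push_cast
    ring
  have hsum' : Summable (a ∘ e) := e.summable_iff.2 hsum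
  rw [e1, ← e.tsum_eq]
  refine (Summable.tsum_prod' hsum'
    (fun b => hsum'.comp_injective (Prod.mk_right_injective b))).trans ?_
  rw [tsum_fintype]
  have e2 : ∀ b : Fin N, ∑' j : ℤ, a (e (b, j)) =
      ∫ u, h u * r (d ((b + 1 : ℕ) : ℤ) - u) := fun b => by
    simp only [he, ha, hd.add_mul_card]
    refine tsum_integral_translates hT hr _ ?_
    refine Continuous.integrable_of_hasCompactSupport (by fun_prop) ?_
    exact (hh.supp.comp_homeomorph (Homeomorph.subLeft (d ((b + 1 : ℕ) : ℤ)))).mul_right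
  refine (Finset.sum_congr rfl fun b _ => e2 b).trans ?_
  rw [Fin.sum_univ_eq_sum_range (fun b => ∫ u, h u * r (d ((b + 1 : ℕ) : ℤ) - u)) N]
  rw [Finset.range_eq_Ico, Finset.sum_Ico_add' (fun b : ℕ => ∫ u, h u * r (d (b : ℤ) - u)) 0 N 1]
  rfl

end IsPeriodicSeq

/-- The uniform distribution on `(0, T]`. -/
noncomputable def unifIoc (T : ℝ) : Measure ℝ := (ENNReal.ofReal T)⁻¹ • volume.restrict (Set.Ioc 0 T)

/-- The uniform distribution on `{1, …, N}`. -/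
noncomputable def unifIcc (N : ℕ) : Measure ℕ :=
  (N : ENNReal)⁻¹ • ∑ n ∈ Finset.Icc 1 N, Measure.dirac n

lemma isProbabilityMeasure_unifIoc {T : ℝ} (hT : 0 < T) : IsProbabilityMeasure (unifIoc T) := by
  refine ⟨?_⟩
  rw [unifIoc, Measure.smul_apply, Measure.restrict_apply_univ, Real.volume_Ioc, sub_zero,
    smul_eq_mul, ENNReal.inv_mul_cancel (by simpa using hT) ENNReal.ofReal_ne_top]

lemma isProbabilityMeasure_unifIcc {N : ℕ} (hN : 0 < N) : IsProbabilityMeasure (unifIcc N) := by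
  refine ⟨?_⟩
  rw [unifIcc, Measure.smul_apply, Measure.finsetSum_apply]
  simp only [measure_univ, Finset.sum_const, Nat.card_Icc, add_tsub_cancel_right, nsmul_eq_mul,
    mul_one, smul_eq_mul]
  exact ENNReal.inv_mul_cancel (by simpa using hN.ne') (ENNReal.natCast_ne_top N)

lemma integral_unifIoc {T : ℝ} (hT : 0 < T) (φ : ℝ → ℝ) :
    ∫ t, φ t ∂(unifIoc T) = T⁻¹ * ∫ t in (0 : ℝ)..T, φ t := by
  rw [unifIoc, integral_smul_measure, ENNReal.toReal_inv, ENNReal.toReal_ofReal hT.le,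
    intervalIntegral.integral_of_le hT.le, smul_eq_mul]

lemma integral_unifIcc (N : ℕ) (φ : ℕ → ℝ) :
    ∫ n, φ n ∂(unifIcc N) = (N : ℝ)⁻¹ * ∑ n ∈ Finset.Icc 1 N, φ n := by
  rw [unifIcc, integral_smul_measure, ENNReal.toReal_inv, ENNReal.toReal_natCast, smul_eq_mul,
    integral_finsetSum_measure fun n _ => integrable_dirac (by simp)]
  simp

theorem IsPeriodicSeq.palmPair {d : ℤ → ℝ} {N : ℕ} {T : ℝ} (hd : IsPeriodicSeq d N T) :
    PalmPair (unifIoc T) (unifIcc N) (fun t f => ∑' n, f (d n - t))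
      (fun m f => ∑' n, f (d n - d (m : ℤ))) (N / T) where
  prob := isProbabilityMeasure_unifIoc hd.period_pos
  prob₀ := isProbabilityMeasure_unifIcc hd.card_pos
  lam_nonneg := div_nonneg (Nat.cast_nonneg N) hd.period_pos.le
  integrable f hf := by
    have h : IntegrableOn (fun t => ∑' n, f (d n - t)) (Set.Ioc 0 T) :=
      (hd.continuous_tsum hf).integrableOn_Ioc
    exact h.smul_measure (by simpa using hd.period_pos)
  aesm₀ f _ := (measurable_of_countable _).aestronglyMeasurable
  posLin := ae_of_all _ hd.isPosLin
  posLin₀ := ae_of_all _ fun m => hd.isPosLin (d m)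
  campbell h f hh hf k := by
    have hN : (N : ℝ) ≠ 0 := by exact_mod_cast hd.card_pos.ne'
    have hrc : Continuous (fun t => k (∑' n, f (d n - t))) := k.continuous.comp (hd.continuous_tsum hf)
    have hr : Function.Periodic (fun t => k (∑' n, f (d n - t))) T :=
      (hd.periodic_tsum f).comp k
    have hi : ∀ m : ℤ, Integrable (fun u => h u * k (∑' n, f (d n - (d m - u)))) := fun m =>
      (hh.cont.mul (hrc.comp (continuous_const.sub continuous_id))).integrable_of_hasCompactSupport
        hh.supp.mul_right
    rw [integral_unifIoc hd.period_pos, hd.integral_tsum_mul hh hrc hr]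
    simp only [integral_unifIcc]
    have e : ∀ u, h u * ((N : ℝ)⁻¹ * ∑ m ∈ Finset.Icc 1 N, k (∑' n, f (d n - d (m : ℤ) + u))) =
        (N : ℝ)⁻¹ * ∑ m ∈ Finset.Icc 1 N, h u * k (∑' n, f (d n - (d (m : ℤ) - u))) := fun u => by
      simp only [Finset.mul_sum, sub_sub_eq_add_sub, sub_add_eq_add_sub]
      exact Finset.sum_congr rfl fun m _ => by ring
    simp only [e]
    rw [integral_const_mul, integral_finsetSum _ fun (m : ℕ) _ => hi m]
    field_simp

section PointSequence

variable {c : ℕ → ℝ} {T : ℝ}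

lemma tendsto_atTop_of_Ncount (hmono : Monotone c) (hpos : ∀ n : ℕ, 1 ≤ n → 0 < c n)
    (hN : Tendsto (fun T => (Ncount c T : ℝ) / T) atTop (𝓝 1)) : Tendsto c atTop atTop := by
  refine tendsto_atTop_atTop_of_monotone hmono fun b => ?_
  by_contra! hb
  have h0 : (fun T => (Ncount c T : ℝ) / T) =ᶠ[atTop] fun _ => 0 := by
    filter_upwards [eventually_ge_atTop b] with T hT
    have e : {n : ℕ | 1 ≤ n ∧ c n ∈ Set.Ioc (0 : ℝ) T} = Set.Ici 1 := by
      ext n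
      exact ⟨fun h => h.1, fun h => ⟨h, hpos n h, (hb n).le.trans hT⟩⟩
    have : Infinite (Set.Ici 1 : Set ℕ) := (Set.Ici_infinite 1).to_subtype
    rw [Ncount, e, Nat.card_eq_zero_of_infinite, Nat.cast_zero, zero_div]
  exact zero_ne_one (tendsto_nhds_unique (tendsto_const_nhds.congr' h0.symm) hN)

lemma le_iff_le_Ncount (hmono : Monotone c) (hpos : ∀ n : ℕ, 1 ≤ n → 0 < c n)
    (hc : Tendsto c atTop atTop) {n : ℕ} (hn : 1 ≤ n) : c n ≤ T ↔ n ≤ Ncount c T := by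
  classical
  have hex : ∃ m, T < c (m + 1) :=
    ((tendsto_add_atTop_iff_nat 1).2 hc |>.eventually_gt_atTop T).exists
  set M := Nat.find hex with hM
  have key : ∀ m, 1 ≤ m → (c m ≤ T ↔ m ≤ M) := fun m hm => by
    constructor
    · intro h
      by_contra! hlt
      exact absurd ((Nat.find_spec hex).trans_le (hmono hlt)) (not_lt.2 h)
    · intro h
      have := Nat.find_min hex (m := m - 1) (by omega)
      rwa [Nat.sub_add_cancel hm, not_lt] at this
  have e : {n : ℕ | 1 ≤ n ∧ c n ∈ Set.Ioc (0 : ℝ) T} = (Finset.Icc 1 M : Finset ℕ) := by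
    ext m
    rw [Finset.coe_Icc]
    exact ⟨fun h => ⟨h.1, (key m h.1).1 h.2.2⟩, fun h => ⟨h.1, hpos m h.1, (key m h.1).2 h.2⟩⟩
  have hNM : Ncount c T = M := by
    rw [Ncount, e]
    simp
  rw [hNM, key n hn]

lemma isPeriodicSeq_cbr (hN : 0 < Ncount c T) (hT : 0 < T) :
    IsPeriodicSeq (cbr c T) (Ncount c T) T := by
  refine ⟨hN, hT, fun n => ?_⟩
  have h : (Ncount c T : ℤ) ≠ 0 := by exact_mod_cast hN.ne'
  have e : n + Ncount c T - 1 = (n - 1) + 1 * (Ncount c T : ℤ) := by ring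
  rw [cbr, cbr, e, Int.add_mul_emod_self_right, Int.add_mul_ediv_right _ _ h]
  push_cast
  ring

lemma cbr_natCast_s15 {m : ℕ} (hm : m ∈ Finset.Icc 1 (Ncount c T)) : cbr c T m = c m := by
  rw [Finset.mem_Icc] at hm
  have e : (m : ℤ) - 1 = ((m - 1 : ℕ) : ℤ) := by omega
  rw [cbr, e, Int.emod_eq_of_lt (by omega) (by omega),
    Int.ediv_eq_zero_of_lt (by omega) (by omega), Int.toNat_natCast, Nat.sub_add_cancel hm.1]
  simp

lemma cbr_nonpos_or_lt (hmono : Monotone c) (hpos : ∀ n : ℕ, 1 ≤ n → 0 < c n)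
    (hc : Tendsto c atTop atTop) (hN : 0 < Ncount c T) (hT : 0 < T) {n : ℤ}
    (hn : ¬ (1 ≤ n ∧ n ≤ Ncount c T)) : cbr c T n ≤ 0 ∨ T < cbr c T n := by
  have hN' : (0 : ℤ) < Ncount c T := by exact_mod_cast hN
  have h1 := Int.emod_nonneg (n - 1) hN'.ne'
  have h2 := Int.emod_lt_of_pos (n - 1) hN'
  have h3 : 1 ≤ ((n - 1) % (Ncount c T : ℤ)).toNat + 1 := by omega
  have h4 := hpos _ h3
  have h5 := (le_iff_le_Ncount hmono hpos hc h3 (T := T)).2 (by omega)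
  rw [cbr]
  rcases lt_or_ge n 1 with h | h
  · left
    have h6 : (n - 1) / (Ncount c T : ℤ) ≤ -1 := by
      have := Int.ediv_neg_of_neg_of_pos (a := n - 1) (by omega) hN'
      omega
    have h7 : (((n - 1) / (Ncount c T : ℤ) : ℤ) : ℝ) ≤ -1 := by exact_mod_cast h6
    nlinarith
  · right
    have h6 : 1 ≤ (n - 1) / (Ncount c T : ℤ) := (Int.le_ediv_iff_mul_le hN').2 (by omega)
    have h7 : (1 : ℝ) ≤ (((n - 1) / (Ncount c T : ℤ) : ℤ) : ℝ) := by exact_mod_cast h6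
    nlinarith

lemma seqStat_eq_sum (hmono : Monotone c) (hpos : ∀ n : ℕ, 1 ≤ n → 0 < c n)
    (hc : Tendsto c atTop atTop) {f : ℝ → ℝ} {R : ℝ} (hf : ∀ x, R ≤ |x| → f x = 0) {t : ℝ}
    (ht : t ≤ T - R) : seqStat c f t = ∑ n ∈ Finset.Icc 1 (Ncount c T), f (c n - t) := by
  rw [seqStat, tsum_eq_sum (s := Finset.Icc 1 (Ncount c T))]
  · exact Finset.sum_congr rfl fun n hn => if_pos (Finset.mem_Icc.1 hn).1
  · intro n hn
    split_ifs with h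
    · have h1 : ¬ c n ≤ T := fun h1 =>
        hn (Finset.mem_Icc.2 ⟨h, (le_iff_le_Ncount hmono hpos hc h).1 h1⟩)
      exact hf _ (le_trans (by linarith) (le_abs_self _))
    · rfl

lemma brStat_eq_sum (hmono : Monotone c) (hpos : ∀ n : ℕ, 1 ≤ n → 0 < c n)
    (hc : Tendsto c atTop atTop) (hN : 0 < Ncount c T) (hT : 0 < T) {f : ℝ → ℝ} {R : ℝ}
    (hf : ∀ x, R ≤ |x| → f x = 0) {t : ℝ} (ht₀ : R ≤ t) (ht : t ≤ T - R) :
    brStat c T f t = ∑ n ∈ Finset.Icc 1 (Ncount c T), f (c n - t) := by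
  rw [brStat, tsum_eq_sum (s := (Finset.Icc 1 (Ncount c T)).map Nat.castEmbedding), Finset.sum_map]
  · exact Finset.sum_congr rfl fun n hn => by
      rw [Nat.castEmbedding_apply, cbr_natCast_s15 hn]
  · intro n hn
    have h : ¬ (1 ≤ n ∧ n ≤ Ncount c T) := fun h => hn <| by
      rw [Finset.mem_map]
      exact ⟨n.toNat, Finset.mem_Icc.2 (by omega), by
        rw [Nat.castEmbedding_apply]
        omega⟩
    rcases cbr_nonpos_or_lt hmono hpos hc hN hT h with h | h
    · exact hf _ (le_trans (by linarith) (neg_le_abs _))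
    · exact hf _ (le_trans (by linarith) (le_abs_self _))

lemma continuous_seqStat_s15 (hmono : Monotone c) (hpos : ∀ n : ℕ, 1 ≤ n → 0 < c n)
    (hc : Tendsto c atTop atTop) {f : ℝ → ℝ} (hf : IsTest f) : Continuous (seqStat c f) := by
  obtain ⟨R, -, hR⟩ := hf.exists_radius
  rw [continuous_iff_continuousAt]
  intro t₀
  have h : (fun t => ∑ n ∈ Finset.Icc 1 (Ncount c (t₀ + 1 + R)), f (c n - t)) =ᶠ[𝓝 t₀]
      seqStat c f := by
    filter_upwards [eventually_lt_nhds (lt_add_one t₀)] with t ht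
    exact (seqStat_eq_sum hmono hpos hc hR (by linarith)).symm
  refine ContinuousAt.congr ?_ h
  have := hf.cont
  fun_prop

lemma tendsto_integral_seqStat_sub_brStat (hmono : Monotone c) (hpos : ∀ n : ℕ, 1 ≤ n → 0 < c n)
    (hN : Tendsto (fun T => (Ncount c T : ℝ) / T) atTop (𝓝 1)) {f : ℝ → ℝ} (hf : IsTest f)
    (g : BoundedContinuousFunction ℝ ℝ) :
    Tendsto (fun T => (∫ t in (0 : ℝ)..T, g (seqStat c f t)) / T -
      T⁻¹ * ∫ t in (0 : ℝ)..T, g (brStat c T f t)) atTop (𝓝 0) := by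
  have hc := tendsto_atTop_of_Ncount hmono hpos hN
  obtain ⟨R, hR₀, hR⟩ := hf.exists_radius
  refine squeeze_zero_norm' (a := fun T => 4 * R * ‖g‖ / T) ?_ (tendsto_const_nhds.div_atTop tendsto_id)
  filter_upwards [hN.eventually_const_lt zero_lt_one, eventually_ge_atTop (2 * R)] with T hNT hRT
  have hT : 0 < T := by linarith
  have hN0 : 0 < Ncount c T := by
    rw [Nat.pos_iff_ne_zero]
    rintro h
    simp [h] at hNT
  have hs : Continuous (fun t => g (seqStat c f t)) :=
    g.continuous.comp (continuous_seqStat_s15 hmono hpos hc hf)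
  have hb : Continuous (fun t => g (brStat c T f t)) :=
    g.continuous.comp ((isPeriodicSeq_cbr hN0 hT).continuous_tsum hf)
  set φ : ℝ → ℝ := fun t => g (seqStat c f t) - g (brStat c T f t) with hφ
  have hφi : ∀ a b, IntervalIntegrable φ volume a b := fun a b =>
    (hs.sub hb).intervalIntegrable a b
  have hφb : ∀ t, ‖φ t‖ ≤ 2 * ‖g‖ := fun t =>
    (norm_sub_le _ _).trans <|
      (add_le_add (g.norm_coe_le_norm _) (g.norm_coe_le_norm _)).trans_eq (two_mul _).symm
  have e0 : ∫ t in R..(T - R), φ t = 0 := by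
    refine (intervalIntegral.integral_congr (g := fun _ => 0) fun t ht => ?_).trans (by simp)
    rw [Set.uIcc_of_le (by linarith)] at ht
    simp only [hφ]
    rw [seqStat_eq_sum hmono hpos hc hR ht.2, brStat_eq_sum hmono hpos hc hN0 hT hR ht.1 ht.2,
      sub_self]
  have e1 : (∫ t in (0 : ℝ)..T, g (seqStat c f t)) - ∫ t in (0 : ℝ)..T, g (brStat c T f t) =
      (∫ t in (0 : ℝ)..R, φ t) + ∫ t in (T - R)..T, φ t := by
    rw [← intervalIntegral.integral_sub (hs.intervalIntegrable _ _) (hb.intervalIntegrable _ _),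
      ← intervalIntegral.integral_add_adjacent_intervals (hφi 0 R) (hφi R T),
      ← intervalIntegral.integral_add_adjacent_intervals (hφi R (T - R)) (hφi (T - R) T), e0,
      zero_add]
  have b1 := intervalIntegral.norm_integral_le_of_norm_le_const (a := 0) (b := R)
    (fun t _ => hφb t)
  have b2 := intervalIntegral.norm_integral_le_of_norm_le_const (a := T - R) (b := T)
    (fun t _ => hφb t)
  rw [sub_zero, abs_of_pos hR₀] at b1
  rw [sub_sub_cancel, abs_of_pos hR₀] at b2
  have e2 : (∫ t in (0 : ℝ)..T, g (seqStat c f t)) / T -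
      T⁻¹ * ∫ t in (0 : ℝ)..T, g (brStat c T f t) =
      ((∫ t in (0 : ℝ)..R, φ t) + ∫ t in (T - R)..T, φ t) / T := by
    rw [← e1]
    ring
  rw [e2, norm_div, Real.norm_of_nonneg hT.le]
  gcongr
  refine (norm_add_le _ _).trans ?_
  linarith

end PointSequence

lemma tendsto_atTop_of_forall_seq {F : ℝ → ℝ} {l : ℝ} {p : ℝ → Prop} (hp : ∀ᶠ T in atTop, p T)
    (h : ∀ u : ℕ → ℝ, (∀ n, p (u n)) → Tendsto u atTop atTop →
      Tendsto (fun n => F (u n)) atTop (𝓝 l)) : Tendsto F atTop (𝓝 l) := by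
  refine tendsto_of_seq_tendsto fun u hu => ?_
  obtain ⟨n₀, hn₀⟩ := eventually_atTop.1 (hu.eventually hp)
  rw [← tendsto_add_atTop_iff_nat n₀]
  exact h (fun n => u (n + n₀)) (fun n => hn₀ _ (by omega)) ((tendsto_add_atTop_iff_nat n₀).2 hu)

section PointSequence

variable {c : ℕ → ℝ}

lemma eventually_palmPair_cbr (hN : Tendsto (fun T => (Ncount c T : ℝ) / T) atTop (𝓝 1)) :
    ∀ᶠ T in atTop, PalmPair (unifIoc T) (unifIcc (Ncount c T)) (fun t f => brStat c T f t)
      (fun m f => brStat c T f (cbr c T (m : ℤ))) (Ncount c T / T) := by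
  filter_upwards [hN.eventually_const_lt zero_lt_one, eventually_gt_atTop 0] with T hNT hT
  refine (isPeriodicSeq_cbr (Nat.pos_of_ne_zero fun h => ?_) hT).palmPair
  simp [h] at hNT

lemma tendsto_seqStat_iff (hmono : Monotone c) (hpos : ∀ n : ℕ, 1 ≤ n → 0 < c n)
    (hN : Tendsto (fun T => (Ncount c T : ℝ) / T) atTop (𝓝 1)) {f : ℝ → ℝ} (hf : IsTest f)
    (g : BoundedContinuousFunction ℝ ℝ) (l : ℝ) :
    Tendsto (fun T => (∫ t in (0 : ℝ)..T, g (seqStat c f t)) / T) atTop (𝓝 l) ↔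
      Tendsto (fun T => ∫ t, g (brStat c T f t) ∂(unifIoc T)) atTop (𝓝 l) := by
  have e : (fun T => ∫ t, g (brStat c T f t) ∂(unifIoc T)) =ᶠ[atTop]
      fun T => T⁻¹ * ∫ t in (0 : ℝ)..T, g (brStat c T f t) := by
    filter_upwards [eventually_gt_atTop 0] with T hT
    exact integral_unifIoc hT _
  have hdiff := tendsto_integral_seqStat_sub_brStat hmono hpos hN hf g
  rw [tendsto_congr' e]
  constructor
  · intro h
    simpa using h.sub hdiff
  · intro h
    simpa using h.add hdiff

end PointSequence

/-- (Prop. `discrete_palm_conv`.) For a non-decreasing positive sequence with `N_c(T) ~ T`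
and a stationary point process `ξ` of intensity `1` with Palm process `ξ^0`: the processes
`ξ_T = {c_n − t}` (with `t` uniform in `(0,T]`) converge in distribution to `ξ` iff the
processes `Ξ̆_T = Σ_j δ_{c̆_j − c̆_n}` (with `n` uniform in `{1,...,N}`) converge in
distribution to `ξ^0`. Convergence in distribution is in the sense of linear statistics. -/
theorem stmt_15 {Ω Ω' : Type*} [MeasurableSpace Ω] [MeasurableSpace Ω']
    (P : MeasureTheory.Measure Ω) (P' : MeasureTheory.Measure Ω')
    [IsProbabilityMeasure P] [IsProbabilityMeasure P']
    (ξ : Ω → MeasureTheory.Measure ℝ) (ξ0 : Ω' → MeasureTheory.Measure ℝ)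
    (hξ : Measurable ξ) (hξ0 : Measurable ξ0)
    (hpp : ∀ᵐ ω ∂P, IsPointMeasure (ξ ω))
    (hpp0 : ∀ᵐ ω' ∂P', IsPointMeasure (ξ0 ω'))
    (hstat : Stationary P ξ) (hint : HasIntensity P ξ 1)
    (hpalm : IsPalmOf P ξ P' ξ0 1)
    (c : ℕ → ℝ) (hmono : Monotone c) (hpos : ∀ n : ℕ, 1 ≤ n → 0 < c n)
    (hN : Tendsto (fun T => (Ncount c T : ℝ) / T) atTop (𝓝 1)) :
    (∀ f : ℝ → ℝ, Continuous f → HasCompactSupport f →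
        ∀ g : BoundedContinuousFunction ℝ ℝ,
        Tendsto (fun T => (∫ t in (0:ℝ)..T, g (seqStat c f t)) / T) atTop
          (𝓝 (∫ ω, g (∫ x, f x ∂(ξ ω)) ∂P))) ↔
    (∀ f : ℝ → ℝ, Continuous f → HasCompactSupport f →
        ∀ g : BoundedContinuousFunction ℝ ℝ,
        Tendsto (fun T => (Ncount c T : ℝ)⁻¹ *
            ∑ n ∈ Finset.Icc 1 (Ncount c T), g (brStat c T f (cbr c T (n : ℤ)))) atTop
          (𝓝 (∫ ω', g (∫ x, f x ∂(ξ0 ω')) ∂P'))) := by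
  have hP' := palmPair_of_isPalmOf P P' ξ ξ0 hξ hξ0 hpp hstat hint hpalm
  constructor
  · intro H f hf hf' g
    have hf : IsTest f := ⟨hf, hf'⟩
    rw [← integral_map_locFinKernel hξ0 hpp0 hf g]
    refine tendsto_atTop_of_forall_seq (eventually_palmPair_cbr hN) fun u hP hu => ?_
    simp only [← integral_unifIcc]
    refine PalmPair.tendsto_palm hP hP' (hN.comp hu) (fun h hh k => ?_) hf g
    rw [integral_map_locFinKernel hξ hpp hh k]
    exact ((tendsto_seqStat_iff hmono hpos hN hh k _).1 (H h hh.cont hh.supp k)).comp hu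
  · intro H f hf hf' g
    have hf : IsTest f := ⟨hf, hf'⟩
    rw [tendsto_seqStat_iff hmono hpos hN hf g, ← integral_map_locFinKernel hξ hpp hf g]
    refine tendsto_atTop_of_forall_seq (eventually_palmPair_cbr hN) fun u hP hu => ?_
    refine PalmPair.tendsto_of_palm hP hP' (hN.comp hu) (fun h hh k => ?_) hf g
    rw [integral_map_locFinKernel hξ0 hpp0 hh k]
    simp only [integral_unifIcc]
    exact (H h hh.cont hh.supp k).comp hu
end
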